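/- arXiv:2602.11991 — 2 statements merged into one kernel-verified Lean document; each statement's English description precedes it below -/
import Mathlib

section
/- Let n ≥ 1, R > 0, θ > 0 and let f : ℝⁿ → ℝ be a C¹ function such that there exist constants m₁, m₂ > 0 with f(p)² − m₁ |p|² |∇_p f(p)|² ≥ m₂ |p|^{2θ} for all p ∈ ℝⁿ. Let u be a function on the open ball B_R(0) ⊂ ℝⁿ that is C¹ on B_R(0) and C³ on B_R(0) ∩ {|∇u| > 0}, and that satisfies div(∇u / √(1 + |∇u|²)) = f(∇u) on B_R(0) (where the equation is interpreted in the nondivergence form (δ^{ij} − u_i u_j/(1+|∇u|²)) u_{ij} = (1+|∇u|²)^{1/2} f(∇u) wherever u is C²). Then there exists a constant C > 0 depending only on n, m₁, m₂ and θ such that |∇u(0)| ≤ C / R^{1/θ}. -/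
open Metric Real Filter

noncomputable def pd1 {n : ℕ} (u : EuclideanSpace ℝ (Fin n) → ℝ) (i : Fin n)
    (x : EuclideanSpace ℝ (Fin n)) : ℝ :=
  fderiv ℝ u x (EuclideanSpace.single i 1)

noncomputable def pd2 {n : ℕ} (u : EuclideanSpace ℝ (Fin n) → ℝ) (i j : Fin n)
    (x : EuclideanSpace ℝ (Fin n)) : ℝ :=
  fderiv ℝ (pd1 u j) x (EuclideanSpace.single i 1)

/-- The coefficients `a^{ij} = δ^{ij} - u_i u_j / (1 + |∇u|²)` of the
nondivergence form of the mean curvature operator. -/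
noncomputable def aCoef {n : ℕ} (u : EuclideanSpace ℝ (Fin n) → ℝ) (i j : Fin n)
    (x : EuclideanSpace ℝ (Fin n)) : ℝ :=
  (if i = j then (1 : ℝ) else 0) - pd1 u i x * pd1 u j x / (1 + ‖gradient u x‖ ^ 2)

/-- The mean curvature operator in nondivergence form: `a^{ij} u_{ij}`. -/
noncomputable def mcOp {n : ℕ} (u : EuclideanSpace ℝ (Fin n) → ℝ)
    (x : EuclideanSpace ℝ (Fin n)) : ℝ :=
  ∑ i, ∑ j, aCoef u i j x * pd2 u i j x

open scoped Topology InnerProductSpace ContDiff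

theorem IsLocalMax.second_deriv_nonpos {h h' : ℝ → ℝ} {h'' x : ℝ} (hmax : IsLocalMax h x)
    (hd : ∀ᶠ t in 𝓝 x, HasDerivAt h (h' t) t) (hd' : HasDerivAt h' h'' x) : h'' ≤ 0 := by
  by_contra! hpos
  have hderiv : deriv h =ᶠ[𝓝 x] h' := hd.mono fun t ht => ht.deriv
  have hmin : IsLocalMin h x := by
    refine isLocalMin_of_deriv_deriv_pos ?_ hmax.deriv_eq_zero hd.self_of_nhds.continuousAt
    rwa [hderiv.deriv_eq, hd'.deriv]
  have hconst : h =ᶠ[𝓝 x] fun _ => h x := by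
    filter_upwards [hmax, hmin] with t h1 h2 using le_antisymm h1 h2
  have hzero : h' =ᶠ[𝓝 x] fun _ => 0 := by
    refine hderiv.symm.trans (hconst.deriv.trans ?_)
    exact Eventually.of_forall fun t => deriv_const t _
  have := (hd'.congr_of_eventuallyEq hzero.symm).unique (hasDerivAt_const x (0 : ℝ))
  exact hpos.ne' this

theorem IsLocalMax.log_add_log_deriv_test {W W' N N' : ℝ → ℝ} {W'' N'' x θ μ : ℝ}
    (hmax : IsLocalMax (fun t => θ * log (W t) + μ * log (N t)) x)
    (hW : ∀ᶠ t in 𝓝 x, HasDerivAt W (W' t) t) (hW' : HasDerivAt W' W'' x)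
    (hN : ∀ᶠ t in 𝓝 x, HasDerivAt N (N' t) t) (hN' : HasDerivAt N' N'' x)
    (hWx : 0 < W x) (hNx : 0 < N x) :
    θ * (W' x / W x) + μ * (N' x / N x) = 0 ∧
      θ * (W'' / W x - (W' x / W x) ^ 2) + μ * (N'' / N x - (N' x / N x) ^ 2) ≤ 0 := by
  have hder : ∀ᶠ t in 𝓝 x, HasDerivAt (fun t => θ * log (W t) + μ * log (N t))
      (θ * (W' t / W t) + μ * (N' t / N t)) t := by
    filter_upwards [hW, hN, hW.self_of_nhds.continuousAt.eventually_ne hWx.ne',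
      hN.self_of_nhds.continuousAt.eventually_ne hNx.ne'] with t h1 h2 h3 h4
    exact ((h1.log h3).const_mul θ).add ((h2.log h4).const_mul μ)
  refine ⟨hmax.hasDerivAt_eq_zero hder.self_of_nhds, ?_⟩
  have hder2 := ((hW'.fun_div hW.self_of_nhds hWx.ne').const_mul θ).fun_add
    ((hN'.fun_div hN.self_of_nhds hNx.ne').const_mul μ)
  have := hmax.second_deriv_nonpos hder hder2
  convert this using 1
  field_simp

section Tilted

variable {ι E : Type*} [Fintype ι] [NormedAddCommGroup E] [InnerProductSpace ℝ E]

/-- The image of the orthonormal basis `b` under the positive square root of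
`1 - p ⊗ p / (1 + ‖p‖ ^ 2)`. -/
noncomputable def tiltedBasis (b : OrthonormalBasis ι ℝ E) (p : E) (i : ι) : E :=
  b i - ((√(1 + ‖p‖ ^ 2) * (√(1 + ‖p‖ ^ 2) + 1))⁻¹ * ⟪b i, p⟫_ℝ) • p

theorem sum_inner_tiltedBasis (b : OrthonormalBasis ι ℝ E) (p : E) (L : E →L[ℝ] E) :
    ∑ i, ⟪tiltedBasis b p i, L (tiltedBasis b p i)⟫_ℝ =
      ∑ i, ⟪b i, L (b i)⟫_ℝ - ⟪p, L p⟫_ℝ / (1 + ‖p‖ ^ 2) := by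
  set s := √(1 + ‖p‖ ^ 2) with hs
  have hs2 : s ^ 2 = 1 + ‖p‖ ^ 2 := Real.sq_sqrt (by positivity)
  have hs0 : 0 < s := Real.sqrt_pos.2 (by positivity)
  set t := (s * (s + 1))⁻¹ with ht
  have h1 : ∑ i, ⟪b i, p⟫_ℝ * ⟪p, L (b i)⟫_ℝ = ⟪p, L p⟫_ℝ := by
    conv_rhs => rw [← b.sum_repr' p, map_sum, inner_sum]
    simp [inner_smul_right, b.sum_repr' p]
  have h2 : ∑ i, ⟪b i, p⟫_ℝ * ⟪b i, L p⟫_ℝ = ⟪p, L p⟫_ℝ := by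
    rw [← b.sum_inner_mul_inner p (L p)]
    simp only [real_inner_comm]
  have h3 : ∑ i, ⟪b i, p⟫_ℝ ^ 2 = ‖p‖ ^ 2 := by
    rw [← real_inner_self_eq_norm_sq, ← b.sum_inner_mul_inner p p]
    simp only [real_inner_comm, sq]
  have h4 : ∀ i, ⟪tiltedBasis b p i, L (tiltedBasis b p i)⟫_ℝ =
      ⟪b i, L (b i)⟫_ℝ - t * (⟪b i, p⟫_ℝ * ⟪p, L (b i)⟫_ℝ) - t * (⟪b i, p⟫_ℝ * ⟪b i, L p⟫_ℝ)
        + t ^ 2 * ⟪p, L p⟫_ℝ * ⟪b i, p⟫_ℝ ^ 2 := by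
    intro i
    simp only [tiltedBasis, ← hs, ← ht, map_sub, map_smul, inner_sub_left, inner_sub_right,
      real_inner_smul_left, real_inner_smul_right]
    ring
  simp only [h4, Finset.sum_add_distrib, Finset.sum_sub_distrib, ← Finset.mul_sum, h1, h2, h3]
  have h5 : ‖p‖ ^ 2 = s ^ 2 - 1 := by linarith
  rw [h5, ht]
  field_simp
  ring

theorem sum_norm_sq_tiltedBasis_le (b : OrthonormalBasis ι ℝ E) (p : E) :
    ∑ i, ‖tiltedBasis b p i‖ ^ 2 ≤ Fintype.card ι := by
  have h := sum_inner_tiltedBasis b p (ContinuousLinearMap.id ℝ E)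
  simp only [ContinuousLinearMap.id_apply, real_inner_self_eq_norm_sq, b.norm_eq_one] at h
  rw [h]
  have : 0 ≤ ‖p‖ ^ 2 / (1 + ‖p‖ ^ 2) := by positivity
  simpa using this

theorem sum_inner_sq_tiltedBasis_le (b : OrthonormalBasis ι ℝ E) (p x : E) :
    ∑ i, ⟪x, tiltedBasis b p i⟫_ℝ ^ 2 ≤ Fintype.card ι * ‖x‖ ^ 2 := by
  calc ∑ i, ⟪x, tiltedBasis b p i⟫_ℝ ^ 2 ≤ ∑ i, ‖tiltedBasis b p i‖ ^ 2 * ‖x‖ ^ 2 := by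
        gcongr with i
        rw [← mul_pow, ← sq_abs]
        gcongr
        rw [mul_comm]
        exact abs_real_inner_le_norm _ _
    _ ≤ _ := by
        rw [← Finset.sum_mul]
        gcongr
        exact sum_norm_sq_tiltedBasis_le b p

theorem sq_sum_inner_tiltedBasis_le (b : OrthonormalBasis ι ℝ E) (p : E) (L : E →L[ℝ] E) :
    (∑ i, ⟪tiltedBasis b p i, L (tiltedBasis b p i)⟫_ℝ) ^ 2 ≤
      Fintype.card ι * ∑ i, ‖L (tiltedBasis b p i)‖ ^ 2 := by
  calc (∑ i, ⟪tiltedBasis b p i, L (tiltedBasis b p i)⟫_ℝ) ^ 2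
      ≤ (∑ i, ‖tiltedBasis b p i‖ * ‖L (tiltedBasis b p i)‖) ^ 2 := by
        rw [← sq_abs]
        gcongr
        refine (Finset.abs_sum_le_sum_abs _ _).trans ?_
        gcongr
        exact abs_real_inner_le_norm _ _
    _ ≤ _ := Finset.sum_mul_sq_le_sq_mul_sq _ _ _
    _ ≤ _ := by
        gcongr
        exact sum_norm_sq_tiltedBasis_le b p

end Tilted

/-- The scalar inequality behind the Bernstein argument, once the test at the maximum point has
been carried out. -/
theorem bernstein_scalar_bound {n m₁ θ w s F P g ρ D S Q : ℝ} (hn : 0 < n) (hm₁ : 0 < m₁)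
    (hθ : 0 < θ) (hw : 0 < w) (hs : 0 < s) (hs2 : s ^ 2 = 1 + w)
    (hPF : m₁ * w * P ^ 2 ≤ F ^ 2) (hg : θ * g = 2 * w * ρ) (hρD : ρ ^ 2 ≤ D)
    (hS : s ^ 2 * F ^ 2 ≤ n * S) (hQ : -(g * |F|) - s * P * g ≤ Q)
    (hmax : θ * (2 * S + 2 * Q) / w ≤ n * (12 + 16 / θ) * D) :
    F ^ 2 ≤ n * (n * (12 + 16 / θ) + 8 * n / θ * (1 + 1 / m₁)) / θ * D := by
  obtain ⟨β, rfl⟩ : ∃ β, g = β * w := ⟨g / w, by field_simp⟩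
  have hβ : θ * β = 2 * ρ := by
    apply mul_right_cancel₀ hw.ne'
    linarith
  have hβD : β ^ 2 ≤ 4 / θ ^ 2 * D := by
    rw [div_mul_eq_mul_div, le_div_iff₀ (by positivity)]
    have : β ^ 2 * θ ^ 2 = 4 * ρ ^ 2 := by linear_combination (θ * β + 2 * ρ) * hβ
    linarith
  set X := s ^ 2 * F ^ 2 / w with hX
  have hXw : X * w = s ^ 2 * F ^ 2 := by rw [hX]; field_simp
  have hFX : F ^ 2 ≤ X := by
    rw [hX, le_div_iff₀ hw]
    nlinarith [sq_nonneg F]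
  have hPX : m₁ * (s * P) ^ 2 ≤ X := by
    rw [hX, le_div_iff₀ hw]
    nlinarith [mul_le_mul_of_nonneg_left hPF (sq_nonneg s)]
  have h1 : 2 * β * |F| ≤ F ^ 2 / (2 * n) + 2 * n * β ^ 2 := by
    have : F ^ 2 / (2 * n) + 2 * n * β ^ 2 - 2 * β * |F| = (|F| - 2 * n * β) ^ 2 / (2 * n) := by
      rw [← sq_abs F]
      field_simp
      ring
    have : 0 ≤ (|F| - 2 * n * β) ^ 2 / (2 * n) := by positivity
    linarith
  have h2 : 2 * β * (s * P) ≤ m₁ * (s * P) ^ 2 / (2 * n) + 2 * n * β ^ 2 / m₁ := by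
    have : m₁ * (s * P) ^ 2 / (2 * n) + 2 * n * β ^ 2 / m₁ - 2 * β * (s * P) =
        (m₁ * (s * P) - 2 * n * β) ^ 2 / (2 * n * m₁) := by
      field_simp
      ring
    have : 0 ≤ (m₁ * (s * P) - 2 * n * β) ^ 2 / (2 * n * m₁) := by positivity
    linarith
  have h3 : X / n - 2 * n * β ^ 2 * (1 + 1 / m₁) ≤ (2 * S + 2 * Q) / w := by
    have hSw : 2 * (X / n) ≤ 2 * S / w := by
      rw [le_div_iff₀ hw, mul_assoc, div_mul_eq_mul_div, hXw]
      have : s ^ 2 * F ^ 2 / n ≤ S := by rw [div_le_iff₀ hn]; linarith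
      linarith
    have hQw : -(2 * β * |F|) - 2 * β * (s * P) ≤ 2 * Q / w := by
      rw [le_div_iff₀ hw]
      linarith
    have h4 : F ^ 2 / (2 * n) ≤ X / (2 * n) := by gcongr
    have h5 : m₁ * (s * P) ^ 2 / (2 * n) ≤ X / (2 * n) := by gcongr
    have h6 : X / (2 * n) = X / n / 2 := by field_simp
    have h7 : 2 * n * β ^ 2 * (1 + 1 / m₁) = 2 * n * β ^ 2 + 2 * n * β ^ 2 / m₁ := by ring
    rw [add_div]
    linarith
  have h8 : θ * (X / n - 2 * n * β ^ 2 * (1 + 1 / m₁)) ≤ n * (12 + 16 / θ) * D := by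
    refine le_trans ?_ hmax
    rw [mul_div_assoc]
    gcongr
  have h9 : 2 * n * β ^ 2 * (1 + 1 / m₁) ≤ 2 * n * (4 / θ ^ 2 * D) * (1 + 1 / m₁) := by gcongr
  have h10 : θ * (X / n) ≤ n * (12 + 16 / θ) * D +
      θ * (2 * n * (4 / θ ^ 2 * D) * (1 + 1 / m₁)) := by
    have := mul_le_mul_of_nonneg_left h9 hθ.le
    linarith
  calc F ^ 2 ≤ X := hFX
    _ = n / θ * (θ * (X / n)) := by field_simp
    _ ≤ n / θ * _ := mul_le_mul_of_nonneg_left h10 (by positivity)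
    _ = _ := by
      field_simp
      ring

section Local

variable {ι E : Type*} [Fintype ι] [NormedAddCommGroup E] [InnerProductSpace ℝ E]

theorem ContDiffAt.eventually_hasFDerivAt {F : Type*} [NormedAddCommGroup F] [NormedSpace ℝ F]
    {G : E → F} {x : E} {k : WithTop ℕ∞} (hG : ContDiffAt ℝ k G x) (hk : 1 ≤ k) (hk' : k ≠ ∞) :
    ∀ᶠ y in 𝓝 x, HasFDerivAt G (fderiv ℝ G y) y :=
  (hG.eventually hk').mono fun _ hy => (hy.differentiableAt (by positivity)).hasFDerivAt

theorem hasDerivAt_add_smul (x v : E) (t : ℝ) : HasDerivAt (fun t : ℝ => x + t • v) v t := by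
  simpa using ((hasDerivAt_id t).smul_const v).const_add x

theorem tendsto_add_smul (x v : E) : Tendsto (fun t : ℝ => x + t • v) (𝓝 0) (𝓝 x) := by
  simpa using (hasDerivAt_add_smul x v 0).continuousAt.tendsto

/-- The first and second derivatives along lines of `‖G‖ ^ 2`. -/
theorem hasDerivAt_norm_sq_line {G : E → E} {x v : E} (hG : ContDiffAt ℝ 2 G x) :
    (∀ᶠ t : ℝ in 𝓝 0, HasDerivAt (fun t : ℝ => ‖G (x + t • v)‖ ^ 2)
      (2 * ⟪G (x + t • v), fderiv ℝ G (x + t • v) v⟫_ℝ) t) ∧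
    HasDerivAt (fun t : ℝ => 2 * ⟪G (x + t • v), fderiv ℝ G (x + t • v) v⟫_ℝ)
      (2 * (⟪G x, fderiv ℝ (fderiv ℝ G) x v v⟫_ℝ + ‖fderiv ℝ G x v‖ ^ 2)) 0 := by
  have hev := hG.eventually_hasFDerivAt one_le_two (by simp)
  have h0 : x = x + (0 : ℝ) • v := by simp
  have hG' : HasFDerivAt (fderiv ℝ G) (fderiv ℝ (fderiv ℝ G) x) x :=
    ((hG.fderiv_right (m := 1) (by norm_num)).differentiableAt one_ne_zero).hasFDerivAt
  constructor
  · filter_upwards [(tendsto_add_smul x v).eventually hev] with t ht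
    exact (ht.comp_hasDerivAt t (hasDerivAt_add_smul x v t)).norm_sq
  · have h1 : HasDerivAt (fun t : ℝ => G (x + t • v)) (fderiv ℝ G x v) 0 :=
      HasFDerivAt.comp_hasDerivAt_of_eq 0 hev.self_of_nhds (hasDerivAt_add_smul x v 0) h0
    have h2 : HasDerivAt (fun t : ℝ => fderiv ℝ G (x + t • v)) (fderiv ℝ (fderiv ℝ G) x v) 0 :=
      HasFDerivAt.comp_hasDerivAt_of_eq 0 hG' (hasDerivAt_add_smul x v 0) h0
    have h3 := h2.clm_apply (hasDerivAt_const (0 : ℝ) v)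
    exact ((h1.inner ℝ h3).const_mul 2).congr_deriv (by simp)

/-- The first and second derivatives along lines of `r ^ 2 - ‖x‖ ^ 2`. -/
theorem hasDerivAt_sub_norm_sq_line (r : ℝ) (x v : E) :
    (∀ t : ℝ, HasDerivAt (fun t : ℝ => r ^ 2 - ‖x + t • v‖ ^ 2) (-(2 * ⟪x + t • v, v⟫_ℝ)) t) ∧
    HasDerivAt (fun t : ℝ => -(2 * ⟪x + t • v, v⟫_ℝ)) (-(2 * ‖v‖ ^ 2)) 0 := by
  refine ⟨fun t => ((hasDerivAt_add_smul x v t).norm_sq).const_sub _, ?_⟩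
  exact (((hasDerivAt_add_smul x v 0).inner ℝ (hasDerivAt_const (0 : ℝ) v)).const_mul 2).fun_neg
    |>.congr_deriv (by simp)

/-- The derivative of the trace form of the mean curvature equation in the direction of `G x`. -/
theorem trace_fderiv_fderiv_eq [CompleteSpace E] (b : OrthonormalBasis ι ℝ E) {G : E → E} {x : E}
    {f : E → ℝ} (hf : DifferentiableAt ℝ f (G x))
    (hG : ContDiffAt ℝ 2 G x)
    (hsymm : ∀ᶠ y in 𝓝 x, ∀ v w, ⟪fderiv ℝ G y v, w⟫_ℝ = ⟪v, fderiv ℝ G y w⟫_ℝ)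
    (heq : ∀ᶠ y in 𝓝 x, ∑ i, ⟪b i, fderiv ℝ G y (b i)⟫_ℝ -
      ⟪G y, fderiv ℝ G y (G y)⟫_ℝ / (1 + ‖G y‖ ^ 2) = √(1 + ‖G y‖ ^ 2) * f (G y)) :
    let p := G x
    let g := fderiv ℝ G x p
    let T := fderiv ℝ (fderiv ℝ G) x p
    ∑ i, ⟪b i, T (b i)⟫_ℝ - ⟪p, T p⟫_ℝ / (1 + ‖p‖ ^ 2) =
      2 * ‖g‖ ^ 2 / (1 + ‖p‖ ^ 2) - 2 * ⟪p, g⟫_ℝ ^ 2 / (1 + ‖p‖ ^ 2) ^ 2 +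
        ⟪p, g⟫_ℝ * f p / √(1 + ‖p‖ ^ 2) + √(1 + ‖p‖ ^ 2) * ⟪gradient f p, g⟫_ℝ := by
  intro p g T
  have hGx : HasFDerivAt G (fderiv ℝ G x) x :=
    (hG.differentiableAt two_ne_zero).hasFDerivAt
  have hG' : HasFDerivAt (fderiv ℝ G) (fderiv ℝ (fderiv ℝ G) x) x :=
    ((hG.fderiv_right (m := 1) (by norm_num)).differentiableAt one_ne_zero).hasFDerivAt
  have h0 : x = x + (0 : ℝ) • p := by simp
  have h1 : HasDerivAt (fun t : ℝ => G (x + t • p)) g 0 :=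
    HasFDerivAt.comp_hasDerivAt_of_eq 0 hGx (hasDerivAt_add_smul x p 0) h0
  have h2 : HasDerivAt (fun t : ℝ => fderiv ℝ G (x + t • p)) T 0 :=
    HasFDerivAt.comp_hasDerivAt_of_eq 0 hG' (hasDerivAt_add_smul x p 0) h0
  have h3 : HasDerivAt (fun t : ℝ => f (G (x + t • p))) ⟪gradient f p, g⟫_ℝ 0 := by
    rw [inner_gradient_left]
    exact HasFDerivAt.comp_hasDerivAt_of_eq 0 hf.hasFDerivAt h1 (by simp)
  have h4 : HasDerivAt (fun t : ℝ => 1 + ‖G (x + t • p)‖ ^ 2) (2 * ⟪p, g⟫_ℝ) 0 := by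
    simpa using h1.norm_sq.const_add 1
  have htr : HasDerivAt (fun t : ℝ => ∑ i, ⟪b i, fderiv ℝ G (x + t • p) (b i)⟫_ℝ)
      (∑ i, ⟪b i, T (b i)⟫_ℝ) 0 := by
    refine HasDerivAt.fun_sum fun i _ => ?_
    simpa using (hasDerivAt_const (0 : ℝ) (b i)).inner ℝ (h2.clm_apply (hasDerivAt_const 0 (b i)))
  have hquad := (h1.inner ℝ (h2.clm_apply h1)).fun_div h4 (by positivity)
  have hrhs := (h4.sqrt (by positivity)).fun_mul h3
  have hline := (tendsto_add_smul x p).eventually heq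
  have key := ((htr.fun_sub hquad).congr_of_eventuallyEq (hline.mono fun t ht => ht.symm)).unique
    hrhs
  have hself : ⟪p, fderiv ℝ G x g⟫_ℝ = ‖g‖ ^ 2 := by
    rw [← hsymm.self_of_nhds, real_inner_self_eq_norm_sq]
  simp only [zero_smul, add_zero, inner_add_right] at key
  change _ - ((⟪p, T p⟫_ℝ + ⟪p, fderiv ℝ G x g⟫_ℝ + ⟪g, g⟫_ℝ) * (1 + ‖p‖ ^ 2) -
    ⟪p, g⟫_ℝ * (2 * ⟪p, g⟫_ℝ)) / (1 + ‖p‖ ^ 2) ^ 2 =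
    2 * ⟪p, g⟫_ℝ / (2 * √(1 + ‖p‖ ^ 2)) * f p + √(1 + ‖p‖ ^ 2) * ⟪gradient f p, g⟫_ℝ at key
  rw [hself, real_inner_self_eq_norm_sq] at key
  have hne : (1 + ‖p‖ ^ 2) ≠ 0 := by positivity
  have hA : ((⟪p, T p⟫_ℝ + ‖g‖ ^ 2 + ‖g‖ ^ 2) * (1 + ‖p‖ ^ 2) -
    ⟪p, g⟫_ℝ * (2 * ⟪p, g⟫_ℝ)) / (1 + ‖p‖ ^ 2) ^ 2 = ⟪p, T p⟫_ℝ / (1 + ‖p‖ ^ 2) +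
      2 * ‖g‖ ^ 2 / (1 + ‖p‖ ^ 2) - 2 * ⟪p, g⟫_ℝ ^ 2 / (1 + ‖p‖ ^ 2) ^ 2 := by
    field_simp
    ring
  have hB : 2 * ⟪p, g⟫_ℝ / (2 * √(1 + ‖p‖ ^ 2)) * f p = ⟪p, g⟫_ℝ * f p / √(1 + ‖p‖ ^ 2) := by
    rw [mul_div_mul_left _ _ two_ne_zero]
    ring
  linarith

/-- The second derivative of a field with symmetric differential is a symmetric trilinear form. -/
theorem inner_fderiv_fderiv_symm {G : E → E} {x : E} (hG : ContDiffAt ℝ 2 G x)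
    (hsymm : ∀ᶠ y in 𝓝 x, ∀ v w, ⟪fderiv ℝ G y v, w⟫_ℝ = ⟪v, fderiv ℝ G y w⟫_ℝ) (p v : E) :
    ⟪p, fderiv ℝ (fderiv ℝ G) x v v⟫_ℝ = ⟪v, fderiv ℝ (fderiv ℝ G) x p v⟫_ℝ := by
  have hG' : HasFDerivAt (fderiv ℝ G) (fderiv ℝ (fderiv ℝ G) x) x :=
    ((hG.fderiv_right (m := 1) (by norm_num)).differentiableAt one_ne_zero).hasFDerivAt
  have h2 : HasDerivAt (fun t : ℝ => fderiv ℝ G (x + t • v)) (fderiv ℝ (fderiv ℝ G) x v) 0 :=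
    HasFDerivAt.comp_hasDerivAt_of_eq 0 hG' (hasDerivAt_add_smul x v 0) (by simp)
  have h3 : HasDerivAt (fun t : ℝ => ⟪p, fderiv ℝ G (x + t • v) v⟫_ℝ)
      ⟪p, fderiv ℝ (fderiv ℝ G) x v v⟫_ℝ 0 := by
    simpa using (hasDerivAt_const (0 : ℝ) p).inner ℝ (h2.clm_apply (hasDerivAt_const 0 v))
  have h4 : HasDerivAt (fun t : ℝ => ⟪v, fderiv ℝ G (x + t • v) p⟫_ℝ)
      ⟪v, fderiv ℝ (fderiv ℝ G) x v p⟫_ℝ 0 := by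
    simpa using (hasDerivAt_const (0 : ℝ) v).inner ℝ (h2.clm_apply (hasDerivAt_const 0 p))
  have h5 : (fun t : ℝ => ⟪p, fderiv ℝ G (x + t • v) v⟫_ℝ) =ᶠ[𝓝 0]
      fun t : ℝ => ⟪v, fderiv ℝ G (x + t • v) p⟫_ℝ := by
    filter_upwards [(tendsto_add_smul x v).eventually hsymm] with t ht
    rw [← ht p v, real_inner_comm]
  rw [h3.unique (h4.congr_of_eventuallyEq h5), (hG.isSymmSndFDerivAt (by simp)).eq]

end Local
section Estimate

variable {ι E : Type*} [Fintype ι] [Nonempty ι] [NormedAddCommGroup E] [InnerProductSpace ℝ E]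
  [CompleteSpace E]

/-- The value at an interior maximum of `‖G‖ ^ (2 * θ) * (r ^ 2 - ‖x‖ ^ 2) ^ 2`. -/
theorem norm_sq_bound_of_isLocalMax (b : OrthonormalBasis ι ℝ E) {G : E → E} {x : E}
    {f : E → ℝ} {θ m₁ r : ℝ} (hθ : 0 < θ) (hm₁ : 0 < m₁)
    (hf : DifferentiableAt ℝ f (G x))
    (hfG : m₁ * ‖G x‖ ^ 2 * ‖gradient f (G x)‖ ^ 2 ≤ f (G x) ^ 2)
    (hG : ContDiffAt ℝ 2 G x) (hGx : G x ≠ 0) (hr : ‖x‖ < r)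
    (hsymm : ∀ᶠ y in 𝓝 x, ∀ v w, ⟪fderiv ℝ G y v, w⟫_ℝ = ⟪v, fderiv ℝ G y w⟫_ℝ)
    (heq : ∀ᶠ y in 𝓝 x, ∑ i, ⟪b i, fderiv ℝ G y (b i)⟫_ℝ -
      ⟪G y, fderiv ℝ G y (G y)⟫_ℝ / (1 + ‖G y‖ ^ 2) = √(1 + ‖G y‖ ^ 2) * f (G y))
    (hmax : IsLocalMax (fun y => θ * log (‖G y‖ ^ 2) + 2 * log (r ^ 2 - ‖y‖ ^ 2)) x) :
    let n : ℝ := Fintype.card ι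
    f (G x) ^ 2 ≤ n * (n * (12 + 16 / θ) + 8 * n / θ * (1 + 1 / m₁)) / θ *
      (r ^ 2 / (r ^ 2 - ‖x‖ ^ 2) ^ 2) := by
  intro n
  set p := G x with hp
  set η := r ^ 2 - ‖x‖ ^ 2 with hη
  set w := ‖p‖ ^ 2 with hw
  have hw0 : 0 < w := by positivity
  have hη0 : 0 < η := sub_pos.2 (by gcongr)
  have hn : 0 < n := by positivity
  set s := √(1 + w) with hs
  have hs2 : s ^ 2 = 1 + w := Real.sq_sqrt (by positivity)
  have hs0 : 0 < s := Real.sqrt_pos.2 (by positivity)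
  set H := fderiv ℝ G x with hH
  set g := H p with hg
  have hHsymm : ∀ v, ⟪p, H v⟫_ℝ = ⟪g, v⟫_ℝ := fun v => (hsymm.self_of_nhds p v).symm
  have htest : ∀ v, θ * (2 * ⟪g, v⟫_ℝ / w) + 2 * (-(2 * ⟪x, v⟫_ℝ) / η) = 0 ∧
      θ * (2 * (⟪v, fderiv ℝ (fderiv ℝ G) x p v⟫_ℝ + ‖H v‖ ^ 2) / w - (2 * ⟪g, v⟫_ℝ / w) ^ 2) +
        2 * (-(2 * ‖v‖ ^ 2) / η - (-(2 * ⟪x, v⟫_ℝ) / η) ^ 2) ≤ 0 := by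
    intro v
    have hline : IsLocalMax (fun t : ℝ => θ * log (‖G (x + t • v)‖ ^ 2) +
        2 * log (r ^ 2 - ‖x + t • v‖ ^ 2)) 0 := by
      simpa [IsLocalMax, IsMaxFilter] using (tendsto_add_smul x v).eventually hmax
    obtain ⟨hW, hW'⟩ := hasDerivAt_norm_sq_line (v := v) hG
    obtain ⟨hN, hN'⟩ := hasDerivAt_sub_norm_sq_line r x v
    have := hline.log_add_log_deriv_test hW hW' (Eventually.of_forall hN) hN'
      (by simpa [← hp] using hw0) (by simpa [← hη] using hη0)
    simpa only [zero_smul, add_zero, ← hp, ← hw, ← hη, ← hH, hHsymm,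
      inner_fderiv_fderiv_symm hG hsymm p v] using this
  have hgx : ∀ v, θ * ⟪g, v⟫_ℝ = 2 * w / η * ⟪x, v⟫_ℝ := by
    intro v
    have := (htest v).1
    field_simp at this ⊢
    linarith
  have hgx' : θ • g = (2 * w / η) • x := by
    refine ext_inner_right ℝ fun v => ?_
    rw [real_inner_smul_left, real_inner_smul_left, hgx v]
  have hgnorm : θ * ‖g‖ = 2 * w * (‖x‖ / η) := by
    have := congrArg norm hgx'
    rw [norm_smul, norm_smul, Real.norm_of_nonneg hθ.le,
      Real.norm_of_nonneg (by positivity)] at this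
    rw [this]
    ring
  set c := tiltedBasis b p with hc
  set S := ∑ i, ‖H (c i)‖ ^ 2 with hS
  set Q := ∑ i, ⟪c i, fderiv ℝ (fderiv ℝ G) x p (c i)⟫_ℝ with hQ
  have hQeq := (sum_inner_tiltedBasis b p (fderiv ℝ (fderiv ℝ G) x p)).trans
    (trace_fderiv_fderiv_eq b hf hG hsymm heq)
  have hHeq := (sum_inner_tiltedBasis b p H).trans heq.self_of_nhds
  have hSF : s ^ 2 * f p ^ 2 ≤ n * S := by
    have := sq_sum_inner_tiltedBasis_le b p H
    rw [hHeq] at this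
    rwa [← mul_pow]
  have hpg : |⟪p, g⟫_ℝ| ≤ s * ‖g‖ := by
    refine (abs_real_inner_le_norm _ _).trans ?_
    gcongr
    exact Real.le_sqrt_of_sq_le (by linarith)
  have hQF : -(‖g‖ * |f p|) - s * ‖gradient f p‖ * ‖g‖ ≤ Q := by
    have h1 : -(‖g‖ * |f p|) ≤ ⟪p, g⟫_ℝ * f p / s := by
      rw [le_div_iff₀ hs0]
      have : |⟪p, g⟫_ℝ * f p| ≤ s * ‖g‖ * |f p| := by
        rw [abs_mul]
        gcongr
      linarith [neg_abs_le (⟪p, g⟫_ℝ * f p)]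
    have h2 : -(‖gradient f p‖ * ‖g‖) ≤ ⟪gradient f p, g⟫_ℝ :=
      neg_le_of_abs_le (abs_real_inner_le_norm _ _)
    have h3 : 2 * ⟪p, g⟫_ℝ ^ 2 / (1 + w) ^ 2 ≤ 2 * ‖g‖ ^ 2 / (1 + w) := by
      have : ⟪p, g⟫_ℝ ^ 2 ≤ (1 + w) * ‖g‖ ^ 2 := by
        rw [← hs2, ← mul_pow, ← sq_abs]
        gcongr
      rw [div_le_div_iff₀ (by positivity) (by positivity)]
      have := mul_le_mul_of_nonneg_right this (show 0 ≤ 2 * (1 + w) by positivity)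
      linarith
    have h4 := mul_le_mul_of_nonneg_left h2 hs0.le
    rw [hQ, hQeq]
    linarith
  have hx2 : ‖x‖ ^ 2 / η ^ 2 ≤ r ^ 2 / η ^ 2 := by gcongr
  have hη1 : 1 / η ≤ r ^ 2 / η ^ 2 := by
    rw [div_le_div_iff₀ hη0 (by positivity)]
    nlinarith [sq_nonneg ‖x‖]
  refine bernstein_scalar_bound hn hm₁ hθ hw0 hs0 hs2 hfG hgnorm ?_ hSF hQF ?_
  · rwa [div_pow]
  · have hterm : ∀ i, θ * (2 * ‖H (c i)‖ ^ 2 +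
        2 * ⟪c i, fderiv ℝ (fderiv ℝ G) x p (c i)⟫_ℝ) / w ≤
        (8 + 16 / θ) / η ^ 2 * ⟪x, c i⟫_ℝ ^ 2 + 4 / η * ‖c i‖ ^ 2 := by
      intro i
      have h1 : 2 * ⟪g, c i⟫_ℝ / w = 4 / (θ * η) * ⟪x, c i⟫_ℝ := by
        have := hgx (c i)
        field_simp at this ⊢
        linarith
      have h2 := (htest (c i)).2
      rw [h1] at h2
      have h3 : θ * (4 / (θ * η) * ⟪x, c i⟫_ℝ) ^ 2 + 2 * (-(2 * ⟪x, c i⟫_ℝ) / η) ^ 2 =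
        (8 + 16 / θ) / η ^ 2 * ⟪x, c i⟫_ℝ ^ 2 := by
        field_simp
        ring
      have h4 : 2 * (-(2 * ‖c i‖ ^ 2) / η) = - (4 / η * ‖c i‖ ^ 2) := by ring
      have h5 : θ * (2 * ‖H (c i)‖ ^ 2 + 2 * ⟪c i, fderiv ℝ (fderiv ℝ G) x p (c i)⟫_ℝ) / w =
        θ * (2 * (⟪c i, fderiv ℝ (fderiv ℝ G) x p (c i)⟫_ℝ + ‖H (c i)‖ ^ 2) / w) := by ring
      linarith
    have hsum := Finset.sum_le_sum fun i (_ : i ∈ Finset.univ) => hterm i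
    simp only [← Finset.sum_div, ← Finset.mul_sum, Finset.sum_add_distrib] at hsum
    refine hsum.trans ?_
    calc _ ≤ (8 + 16 / θ) / η ^ 2 * (n * ‖x‖ ^ 2) + 4 / η * n := by
          gcongr
          · exact sum_inner_sq_tiltedBasis_le b p x
          · exact sum_norm_sq_tiltedBasis_le b p
      _ = n * (8 + 16 / θ) * (‖x‖ ^ 2 / η ^ 2) + 4 * n * (1 / η) := by ring
      _ ≤ n * (8 + 16 / θ) * (r ^ 2 / η ^ 2) + 4 * n * (r ^ 2 / η ^ 2) := by gcongr
      _ = _ := by ring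

end Estimate

section Euclidean

variable {n : ℕ} {u : EuclideanSpace ℝ (Fin n) → ℝ} {x : EuclideanSpace ℝ (Fin n)}

theorem pd1_eq_gradient_apply (u : EuclideanSpace ℝ (Fin n) → ℝ) (i : Fin n)
    (x : EuclideanSpace ℝ (Fin n)) : pd1 u i x = gradient u x i := by
  rw [pd1, ← inner_gradient_left, EuclideanSpace.inner_single_right]
  simp

theorem pd2_eq_fderiv_gradient (hG : DifferentiableAt ℝ (gradient u) x) (i j : Fin n) :
    pd2 u i j x = fderiv ℝ (gradient u) x (EuclideanSpace.single i 1) j := by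
  have h : pd1 u j = (EuclideanSpace.proj j : EuclideanSpace ℝ (Fin n) →L[ℝ] ℝ) ∘ gradient u :=
    funext fun y => pd1_eq_gradient_apply u j y
  rw [pd2, h, ((EuclideanSpace.proj j).hasFDerivAt.comp x hG.hasFDerivAt).fderiv]
  rfl

theorem contDiffAt_gradient {k m : WithTop ℕ∞} (hu : ContDiffAt ℝ k u x) (hm : m + 1 ≤ k) :
    ContDiffAt ℝ m (gradient u) x := by
  rw [contDiffAt_euclidean]
  intro i
  simp only [← pd1_eq_gradient_apply]
  exact (hu.fderiv_right hm).clm_apply contDiffAt_const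

theorem inner_fderiv_gradient_symm (hu : ContDiffAt ℝ 2 u x) (v w : EuclideanSpace ℝ (Fin n)) :
    ⟪fderiv ℝ (gradient u) x v, w⟫_ℝ = ⟪v, fderiv ℝ (gradient u) x w⟫_ℝ := by
  have hG : HasFDerivAt (gradient u) (fderiv ℝ (gradient u) x) x :=
    ((contDiffAt_gradient hu (m := 1) (by norm_num)).differentiableAt one_ne_zero).hasFDerivAt
  have hD : HasFDerivAt (fderiv ℝ u) (fderiv ℝ (fderiv ℝ u) x) x :=
    ((hu.fderiv_right (m := 1) (by norm_num)).differentiableAt one_ne_zero).hasFDerivAt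
  have key : ∀ v w, ⟪fderiv ℝ (gradient u) x v, w⟫_ℝ = fderiv ℝ (fderiv ℝ u) x v w := by
    intro v w
    have h1 := hG.inner ℝ (hasFDerivAt_const w x)
    have h2 := hD.clm_apply (hasFDerivAt_const w x)
    simp only [inner_gradient_left] at h1
    simpa using congrArg (fun L => L v) (h1.unique h2)
  rw [key, ← real_inner_comm, key, (hu.isSymmSndFDerivAt (by simp)).eq]

theorem mcOp_eq_trace (hG : DifferentiableAt ℝ (gradient u) x) :
    mcOp u x = ∑ i, ⟪EuclideanSpace.basisFun (Fin n) ℝ i,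
        fderiv ℝ (gradient u) x (EuclideanSpace.basisFun (Fin n) ℝ i)⟫_ℝ -
      ⟪gradient u x, fderiv ℝ (gradient u) x (gradient u x)⟫_ℝ / (1 + ‖gradient u x‖ ^ 2) := by
  set p := gradient u x
  set H := fderiv ℝ (gradient u) x
  have hp : H p = ∑ i, p i • H (EuclideanSpace.single i 1) := by
    conv_lhs => rw [← (EuclideanSpace.basisFun (Fin n) ℝ).sum_repr p, map_sum]
    simp
  have hpp : ⟪p, H p⟫_ℝ = ∑ i, ∑ j, p i * p j * H (EuclideanSpace.single i 1) j := by
    rw [hp, inner_sum]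
    refine Finset.sum_congr rfl fun i _ => ?_
    rw [inner_smul_right, PiLp.inner_apply, Finset.mul_sum]
    refine Finset.sum_congr rfl fun j _ => ?_
    simp
    ring
  rw [hpp, Finset.sum_div, ← Finset.sum_sub_distrib, mcOp]
  refine Finset.sum_congr rfl fun i _ => ?_
  simp only [aCoef, pd1_eq_gradient_apply, pd2_eq_fderiv_gradient hG, sub_mul, ite_mul, one_mul,
    zero_mul, Finset.sum_sub_distrib, Finset.sum_ite_eq, Finset.mem_univ, if_true, Finset.sum_div,
    EuclideanSpace.basisFun_apply, EuclideanSpace.inner_single_left]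
  simp [div_mul_eq_mul_div, p, H]

end Euclidean

/-- The interior bound for the power of the gradient, on a compactly contained ball. -/
theorem norm_gradient_rpow_le {n : ℕ} (hn : 1 ≤ n) {θ m₁ m₂ r R : ℝ} (hθ : 0 < θ) (hm₁ : 0 < m₁)
    (hm₂ : 0 < m₂) (hr : 0 < r) (hrR : r < R) {f : EuclideanSpace ℝ (Fin n) → ℝ}
    (hf : ContDiff ℝ 1 f)
    (hfb : ∀ p : EuclideanSpace ℝ (Fin n),
      f p ^ 2 - m₁ * ‖p‖ ^ 2 * ‖gradient f p‖ ^ 2 ≥ m₂ * ‖p‖ ^ (2 * θ))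
    {u : EuclideanSpace ℝ (Fin n) → ℝ} (hu : ContDiffOn ℝ 1 u (ball 0 R))
    (hu3 : ContDiffOn ℝ 3 u (ball 0 R ∩ {x | gradient u x ≠ 0}))
    (heq : ∀ x ∈ ball (0 : EuclideanSpace ℝ (Fin n)) R, gradient u x ≠ 0 →
      mcOp u x = √(1 + ‖gradient u x‖ ^ 2) * f (gradient u x)) (h0 : gradient u 0 ≠ 0) :
    ‖gradient u 0‖ ^ (2 * θ) ≤
      n * (n * (12 + 16 / θ) + 8 * n / θ * (1 + 1 / m₁)) / θ / m₂ / r ^ 2 := by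
  set K : ℝ := n * (n * (12 + 16 / θ) + 8 * n / θ * (1 + 1 / m₁)) / θ with hK
  have : Nonempty (Fin n) := ⟨⟨0, hn⟩⟩
  set G := gradient u with hG
  have hGc : ContinuousOn G (ball 0 R) :=
    (InnerProductSpace.toDual ℝ (EuclideanSpace ℝ (Fin n))).symm.continuous.comp_continuousOn
      (hu.continuousOn_fderiv_of_isOpen isOpen_ball le_rfl)
  have hopen : IsOpen (ball 0 R ∩ {x | G x ≠ 0}) :=
    hGc.isOpen_inter_preimage isOpen_ball isOpen_ne
  set Ψ : EuclideanSpace ℝ (Fin n) → ℝ := fun y => ‖G y‖ ^ (2 * θ) * (r ^ 2 - ‖y‖ ^ 2) ^ 2 with hΨ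
  have hΨc : ContinuousOn Ψ (closedBall 0 r) := by
    refine ContinuousOn.mul ?_ (by fun_prop)
    exact ((hGc.mono (closedBall_subset_ball hrR)).norm).rpow_const fun _ _ => Or.inr (by positivity)
  obtain ⟨x, hx, hxmax⟩ := (isCompact_closedBall (0 : EuclideanSpace ℝ (Fin n)) r).exists_isMaxOn
    ⟨0, mem_closedBall_self hr.le⟩ hΨc
  have hΨ0 : Ψ 0 = ‖G 0‖ ^ (2 * θ) * r ^ 4 := by
    simp only [hΨ, norm_zero]
    ring
  have h0x : Ψ 0 ≤ Ψ x := hxmax (mem_closedBall_self hr.le)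
  have hΨx : 0 < Ψ x := lt_of_lt_of_le (by rw [hΨ0]; positivity) h0x
  have hGx : G x ≠ 0 := by
    intro h
    simp [hΨ, h, Real.zero_rpow (by positivity : 2 * θ ≠ 0)] at hΨx
  have hxr : ‖x‖ < r := by
    refine lt_of_le_of_ne (by simpa using hx) fun h => ?_
    simp [hΨ, h] at hΨx
  have hη : 0 < r ^ 2 - ‖x‖ ^ 2 := sub_pos.2 (by gcongr)
  have hΩ : ball 0 R ∩ {x | G x ≠ 0} ∈ 𝓝 x :=
    hopen.mem_nhds ⟨by simpa using hxr.trans hrR, hGx⟩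
  have hu3_near : ∀ᶠ y in 𝓝 x, ContDiffAt ℝ 3 u y := by
    filter_upwards [hopen.mem_nhds (mem_of_mem_nhds hΩ)] with y hy
    exact hu3.contDiffAt (hopen.mem_nhds hy)
  have hlog : ∀ y, ‖y‖ < r → G y ≠ 0 →
      θ * log (‖G y‖ ^ 2) + 2 * log (r ^ 2 - ‖y‖ ^ 2) = log (Ψ y) := by
    intro y hy hGy
    have : 0 < r ^ 2 - ‖y‖ ^ 2 := sub_pos.2 (by gcongr)
    have hGy' : 0 < ‖G y‖ := norm_pos_iff.2 hGy
    rw [hΨ, log_mul (by positivity) (by positivity), log_rpow hGy', log_pow, log_pow]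
    push_cast
    ring
  have hmax : IsLocalMax (fun y => θ * log (‖G y‖ ^ 2) + 2 * log (r ^ 2 - ‖y‖ ^ 2)) x := by
    filter_upwards [hΩ, isOpen_ball.mem_nhds (show x ∈ ball 0 r by simpa using hxr)] with y hy hyr
    have hyr' : ‖y‖ < r := by simpa using hyr
    have hη' : 0 < r ^ 2 - ‖y‖ ^ 2 := sub_pos.2 (by gcongr)
    have hGy' : 0 < ‖G y‖ := norm_pos_iff.2 hy.2
    rw [hlog y hyr' hy.2, hlog x hxr hGx]
    exact log_le_log (by positivity) (hxmax (ball_subset_closedBall hyr))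
  have hfGx := hfb (G x)
  have hbound := norm_sq_bound_of_isLocalMax (EuclideanSpace.basisFun (Fin n) ℝ) hθ hm₁
    (hf.differentiable one_ne_zero _) (by
      have : 0 ≤ m₂ * ‖G x‖ ^ (2 * θ) := by positivity
      linarith)
    (contDiffAt_gradient hu3_near.self_of_nhds (by norm_num)) hGx hxr
    (hu3_near.mono fun y hy => inner_fderiv_gradient_symm (hy.of_le (by norm_num)))
    (by
      filter_upwards [hΩ, hu3_near] with y hy hy3
      rw [← heq y hy.1 hy.2, mcOp_eq_trace]
      exact (contDiffAt_gradient (m := 1) hy3 (by norm_num)).differentiableAt one_ne_zero) hmax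
  simp only [Fintype.card_fin, ← hK] at hbound
  have hΨxK : m₂ * Ψ x ≤ K * r ^ 2 := by
    have h1 : 0 ≤ m₁ * ‖G x‖ ^ 2 * ‖gradient f (G x)‖ ^ 2 := by positivity
    have h2 : m₂ * ‖G x‖ ^ (2 * θ) ≤ K * r ^ 2 / (r ^ 2 - ‖x‖ ^ 2) ^ 2 := by
      rw [mul_div_assoc]
      linarith
    rw [le_div_iff₀ (by positivity)] at h2
    rw [hΨ]
    linarith
  rw [div_div, le_div_iff₀ (by positivity)]
  have h3 := (mul_le_mul_of_nonneg_left h0x hm₂.le).trans hΨxK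
  rw [hΨ0] at h3
  refine le_of_mul_le_mul_right ?_ (show 0 < r ^ 2 by positivity)
  linarith

/-- Theorem 1.1 (a): interior gradient estimate under assumption (A1). -/
theorem gradient_estimate_A1 (n : ℕ) (hn : 1 ≤ n) (θ m₁ m₂ : ℝ)
    (hθ : 0 < θ) (hm₁ : 0 < m₁) (hm₂ : 0 < m₂) :
    ∃ C > 0, ∀ R : ℝ, 0 < R →
      ∀ f : EuclideanSpace ℝ (Fin n) → ℝ, ContDiff ℝ 1 f →
      (∀ p : EuclideanSpace ℝ (Fin n),
        f p ^ 2 - m₁ * ‖p‖ ^ 2 * ‖gradient f p‖ ^ 2 ≥ m₂ * ‖p‖ ^ (2 * θ)) →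
      ∀ u : EuclideanSpace ℝ (Fin n) → ℝ,
        ContDiffOn ℝ 1 u (ball 0 R) →
        ContDiffOn ℝ 3 u (ball 0 R ∩ {x | gradient u x ≠ 0}) →
        (∀ x ∈ ball (0 : EuclideanSpace ℝ (Fin n)) R, gradient u x ≠ 0 →
          mcOp u x = Real.sqrt (1 + ‖gradient u x‖ ^ 2) * f (gradient u x)) →
        ‖gradient u 0‖ ≤ C / R ^ ((1 : ℝ) / θ) := by
  have hn' : (0 : ℝ) < n := by exact_mod_cast hn
  set K : ℝ := n * (n * (12 + 16 / θ) + 8 * n / θ * (1 + 1 / m₁)) / θ / m₂ with hK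
  have hK0 : 0 < K := by positivity
  refine ⟨(4 * K) ^ (1 / (2 * θ)), by positivity, fun R hR f hf hfb u hu hu3 heq => ?_⟩
  by_cases h0 : gradient u 0 = 0
  · rw [h0, norm_zero]
    positivity
  have h := norm_gradient_rpow_le hn hθ hm₁ hm₂ (half_pos hR) (half_lt_self hR) hf hfb hu hu3 heq h0
  have hR2 : R ^ (1 / θ) = (R ^ 2) ^ (1 / (2 * θ)) := by
    rw [← Real.rpow_natCast, ← Real.rpow_mul hR.le]
    congr 1
    field_simp
    norm_num
  rw [hR2, ← Real.div_rpow (by positivity) (by positivity)]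
  calc ‖gradient u 0‖ = (‖gradient u 0‖ ^ (2 * θ)) ^ (1 / (2 * θ)) := by
        rw [← Real.rpow_mul (norm_nonneg _), mul_one_div_cancel (by positivity), Real.rpow_one]
    _ ≤ _ := by
        gcongr
        refine h.trans_eq ?_
        rw [← hK]
        field_simp
        norm_num
end

section
/- Let n ≥ 1, R > 0, 0 < θ ≤ 1, m₁ > 0 and let f(p) = m₁ log^{θ}(1+|p|²). Let u be a function on B_R(0) ⊂ ℝⁿ that is C¹ on B_R(0) and C³ on B_R(0) ∩ {|∇u| > 0}, and that satisfies div(∇u/√(1+|∇u|²)) = f(∇u) on B_R(0). Set L = sup_{x,y ∈ B_R(0)} |u(x) − u(y)|. Then for every 0 < η < 1 there exist constants C₁ > 0 depending only on n, m₁, θ and C₂ > 0 depending only on n, m₁, η, θ such that |∇u(0)|² ≤ max{ exp(C₁ (L+1)^{1/(2θ)} / R^{1/θ}) − 1 , exp(C₂ (L+1)^{1/(1−η)} / R^{2/(1−η)}) − 1 }. -/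
open Metric Real Filter

section PartialDerivatives

open Topology

variable {n : ℕ} {g h : EuclideanSpace ℝ (Fin n) → ℝ} {x : EuclideanSpace ℝ (Fin n)}

lemma clm_apply_eq_sum_single (φ : EuclideanSpace ℝ (Fin n) →L[ℝ] ℝ)
    (w : EuclideanSpace ℝ (Fin n)) :
    φ w = ∑ i, w i * φ (EuclideanSpace.single i 1) := by
  have hw : w = ∑ i, w i • EuclideanSpace.single i (1 : ℝ) := by
    ext j
    simp [Pi.single_apply]
  conv_lhs => rw [hw]
  simp

lemma gradient_apply_eq_pd1 (u : EuclideanSpace ℝ (Fin n) → ℝ) (i : Fin n) :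
    gradient u x i = pd1 u i x := by
  have h := InnerProductSpace.toDual_symm_apply (𝕜 := ℝ) (x := EuclideanSpace.single i (1 : ℝ))
    (y := fderiv ℝ u x)
  rw [pd1, ← h, gradient, EuclideanSpace.inner_single_right]
  simp

lemma norm_gradient_sq (u : EuclideanSpace ℝ (Fin n) → ℝ) :
    ‖gradient u x‖ ^ 2 = ∑ i, pd1 u i x ^ 2 := by
  simp [EuclideanSpace.real_norm_sq_eq, gradient_apply_eq_pd1]

lemma contDiffAt_pd1 {m k : WithTop ℕ∞} (hg : ContDiffAt ℝ k g x) (hmk : m + 1 ≤ k) (i : Fin n) :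
    ContDiffAt ℝ m (pd1 g i) x :=
  (hg.fderiv_right hmk).clm_apply contDiffAt_const

lemma pd1_pd1_comm (hg : ContDiffAt ℝ 2 g x) (i j : Fin n) :
    pd1 (pd1 g j) i x = pd1 (pd1 g i) j x := by
  have hd : DifferentiableAt ℝ (fderiv ℝ g) x :=
    (hg.fderiv_right (m := 1) (by norm_num)).differentiableAt (by norm_num)
  have key (i j : Fin n) : pd1 (pd1 g j) i x =
      fderiv ℝ (fderiv ℝ g) x (EuclideanSpace.single i 1) (EuclideanSpace.single j 1) := by
    have h := (hd.hasFDerivAt.clm_apply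
      (hasFDerivAt_const (EuclideanSpace.single j (1 : ℝ)) x)).fderiv
    change fderiv ℝ (fun y => fderiv ℝ g y (EuclideanSpace.single j 1)) x _ = _
    rw [h]
    simp
  rw [key, key, (hg.isSymmSndFDerivAt (by simp)).eq]

lemma pd1_congr (hgh : g =ᶠ[𝓝 x] h) (i : Fin n) : pd1 g i x = pd1 h i x := by
  simp [pd1, hgh.fderiv_eq]

lemma pd1_fun_add (hg : DifferentiableAt ℝ g x) (hh : DifferentiableAt ℝ h x) (i : Fin n) :
    pd1 (fun y => g y + h y) i x = pd1 g i x + pd1 h i x := by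
  simp [pd1, fderiv_fun_add hg hh]

lemma pd1_fun_sub (hg : DifferentiableAt ℝ g x) (hh : DifferentiableAt ℝ h x) (i : Fin n) :
    pd1 (fun y => g y - h y) i x = pd1 g i x - pd1 h i x := by
  simp [pd1, fderiv_fun_sub hg hh]

lemma pd1_fun_mul (hg : DifferentiableAt ℝ g x) (hh : DifferentiableAt ℝ h x) (i : Fin n) :
    pd1 (fun y => g y * h y) i x = g x * pd1 h i x + h x * pd1 g i x := by
  simp [pd1, fderiv_fun_mul hg hh]

lemma pd1_const_mul (hg : DifferentiableAt ℝ g x) (c : ℝ) (i : Fin n) :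
    pd1 (fun y => c * g y) i x = c * pd1 g i x := by
  simp [pd1, fderiv_const_mul hg]

lemma pd1_const_add (c : ℝ) (i : Fin n) : pd1 (fun y => c + g y) i x = pd1 g i x := by
  simp [pd1]

lemma pd1_fun_sum {ι : Type*} {s : Finset ι} {G : ι → EuclideanSpace ℝ (Fin n) → ℝ}
    (hG : ∀ k ∈ s, DifferentiableAt ℝ (G k) x) (i : Fin n) :
    pd1 (fun y => ∑ k ∈ s, G k y) i x = ∑ k ∈ s, pd1 (G k) i x := by
  simp [pd1, fderiv_fun_sum hG]

lemma pd1_comp {φ : ℝ → ℝ} {φ' : ℝ} (hφ : HasDerivAt φ φ' (g x))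
    (hg : DifferentiableAt ℝ g x) (i : Fin n) :
    pd1 (fun y => φ (g y)) i x = φ' * pd1 g i x := by
  have := (hφ.comp_hasFDerivAt x hg.hasFDerivAt).fderiv
  simp only [pd1]
  rw [show (fun y => φ (g y)) = φ ∘ g from rfl, this]
  simp

lemma pd1_coord (i j : Fin n) :
    pd1 (fun y : EuclideanSpace ℝ (Fin n) => y j) i x = if i = j then 1 else 0 := by
  have : (fun y : EuclideanSpace ℝ (Fin n) => y j) = EuclideanSpace.proj (𝕜 := ℝ) j := by
    ext; simp
  simp only [pd1]
  rw [this, ContinuousLinearMap.fderiv]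
  simp [eq_comm]

lemma IsLocalMax.pd1_eq_zero (hg : IsLocalMax g x) (i : Fin n) : pd1 g i x = 0 := by
  simp [pd1, hg.fderiv_eq_zero]

lemma IsLocalMax.sum_pd1_pd1_nonpos (hmax : IsLocalMax g x) (hg : ContDiffAt ℝ 2 g x)
    (w : Fin n → ℝ) : ∑ i, ∑ j, w i * w j * pd1 (pd1 g j) i x ≤ 0 := by
  set e : EuclideanSpace ℝ (Fin n) := WithLp.toLp 2 w with he
  have hline (t : ℝ) : HasDerivAt (fun t : ℝ => x + t • e) e t := by
    simpa using ((hasDerivAt_id t).smul_const e).const_add x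
  have hcont : Tendsto (fun t : ℝ => x + t • e) (𝓝 0) (𝓝 x) := by
    have := (hline 0).continuousAt.tendsto
    simpa using this
  have hev : ∀ᶠ t in 𝓝 (0 : ℝ), deriv (fun t : ℝ => g (x + t • e)) t =
      ∑ j, w j * pd1 g j (x + t • e) := by
    have h1 := hcont.eventually (hg.eventually (by simp))
    filter_upwards [h1] with t ht
    have h2 := ((ht.differentiableAt (by norm_num)).hasFDerivAt.comp_hasDerivAt t (hline t)).deriv
    rw [Function.comp_def] at h2
    rw [h2, clm_apply_eq_sum_single]
    rfl
  have hd0 : deriv (fun t : ℝ => g (x + t • e)) 0 = 0 := by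
    rw [hev.self_of_nhds]
    simp [hmax.pd1_eq_zero]
  have hdd : deriv (deriv (fun t : ℝ => g (x + t • e))) 0 =
      ∑ i, ∑ j, w i * w j * pd1 (pd1 g j) i x := by
    rw [Filter.EventuallyEq.deriv_eq hev]
    have h1 (j : Fin n) : HasDerivAt (fun t : ℝ => w j * pd1 g j (x + t • e))
        (w j * fderiv ℝ (pd1 g j) x e) 0 := by
      have h2 : HasFDerivAt (pd1 g j) (fderiv ℝ (pd1 g j) x) (x + (0 : ℝ) • e) := by
        simpa using ((contDiffAt_pd1 hg (m := 1) (by norm_num) j).differentiableAt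
          (by norm_num)).hasFDerivAt
      exact (h2.comp_hasDerivAt 0 (hline 0)).const_mul (w j)
    rw [(HasDerivAt.fun_sum fun j _ => h1 j).deriv, Finset.sum_comm]
    refine Finset.sum_congr rfl fun j _ => ?_
    rw [clm_apply_eq_sum_single, Finset.mul_sum]
    refine Finset.sum_congr rfl fun i _ => ?_
    simp only [he, pd1]
    ring
  have hlmax : IsLocalMax (fun t : ℝ => g (x + t • e)) 0 := by
    have := hcont.eventually hmax
    simpa [IsLocalMax, IsMaxFilter] using this
  by_contra! hpos
  rw [← hdd] at hpos
  have hcg : ContinuousAt (fun t : ℝ => g (x + t • e)) 0 := by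
    have h3 : ContinuousAt g (x + (0 : ℝ) • e) := by simpa using hg.continuousAt
    exact ContinuousAt.comp (f := fun t : ℝ => x + t • e) h3 (hline 0).continuousAt
  have hlmin := isLocalMin_of_deriv_deriv_pos hpos hd0 hcg
  have hconst : (fun t : ℝ => g (x + t • e)) =ᶠ[𝓝 0] fun _ => g (x + (0 : ℝ) • e) := by
    filter_upwards [hlmin, hlmax] with t h1 h2 using le_antisymm h2 h1
  have h0 : deriv (fun t : ℝ => g (x + t • e)) =ᶠ[𝓝 0] fun _ => 0 := by
    simpa using hconst.deriv
  rw [h0.deriv_eq] at hpos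
  simp at hpos

end PartialDerivatives

section LinearAlgebra

variable {n : ℕ}

lemma sum_mul_sq_div_le (p ξ : Fin n → ℝ) {v : ℝ} (hv : v ^ 2 = 1 + ∑ i, p i ^ 2) :
    (∑ i, p i * ξ i) ^ 2 / v ^ 2 ≤ ∑ i, ξ i ^ 2 := by
  have hp : 0 ≤ ∑ i, p i ^ 2 := Finset.sum_nonneg fun i _ => sq_nonneg _
  have hξ : 0 ≤ ∑ i, ξ i ^ 2 := Finset.sum_nonneg fun i _ => sq_nonneg _
  rw [div_le_iff₀ (by linarith)]
  nlinarith [Finset.sum_mul_sq_le_sq_mul_sq Finset.univ p ξ]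

lemma trace_sub_div_nonpos (p : Fin n → ℝ) (M : Fin n → Fin n → ℝ) {v : ℝ} (hv0 : 0 < v)
    (hv : v ^ 2 = 1 + ∑ i, p i ^ 2) (hM : ∀ w : Fin n → ℝ, ∑ i, ∑ j, w i * w j * M i j ≤ 0) :
    ∑ i, M i i - (∑ i, ∑ j, p i * p j * M i j) / v ^ 2 ≤ 0 := by
  set β := 1 / (v * (v + 1)) with hβ
  set q := ∑ i, ∑ j, p i * p j * M i j with hq
  have key (m : Fin n) : ∑ i, ∑ j, ((if i = m then 1 else 0) - β * p m * p i) *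
      ((if j = m then 1 else 0) - β * p m * p j) * M i j =
      M m m - β * (∑ j, p m * p j * M m j) - β * (∑ i, p i * p m * M i m) +
        β ^ 2 * p m ^ 2 * q := by
    have h1 (i j : Fin n) : ((if i = m then 1 else 0) - β * p m * p i) *
      ((if j = m then 1 else 0) - β * p m * p j) * M i j =
      (if i = m then (if j = m then M i j else 0) else 0) -
        β * (if i = m then p m * p j * M i j else 0) -
        β * (if j = m then p i * p m * M i j else 0) +
        β ^ 2 * p m ^ 2 * (p i * p j * M i j) := by
      split_ifs <;> ring
    simp only [h1, Finset.sum_add_distrib, Finset.sum_sub_distrib, ← Finset.mul_sum, hq]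
    congr 1
    congr 1
    · congr 1
      · simp
      · rw [Finset.sum_comm]; simp
    · simp
  have hsum := Finset.sum_nonpos fun (m : Fin n) (_ : m ∈ Finset.univ) =>
    (key m).symm.trans_le (hM fun i => (if i = m then 1 else 0) - β * p m * p i)
  simp only [Finset.sum_add_distrib, Finset.sum_sub_distrib, ← Finset.mul_sum,
    ← Finset.sum_mul] at hsum
  rw [Finset.sum_comm (f := fun x i => p i * p x * M i x), ← hq] at hsum
  have hP : ∑ i, p i ^ 2 = v ^ 2 - 1 := by linarith
  rw [hP] at hsum
  refine le_of_eq_of_le ?_ hsum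
  rw [hβ]
  field_simp
  ring

lemma bochner_lower_bound (hn : 1 ≤ n) (p l : Fin n → ℝ) (H Λ T : Fin n → Fin n → ℝ)
    {v B B' : ℝ} (hv0 : 0 < v) (hv : v ^ 2 = 1 + ∑ i, p i ^ 2) (hH : ∀ i j, H i j = H j i)
    (hl : ∀ i, 2 * ∑ k, p k * H i k = v ^ 2 * l i)
    (hΛ : ∀ i, 2 * ∑ k, H i k ^ 2 + 2 * ∑ k, p k * T k i = v ^ 2 * (l i ^ 2 + Λ i i))
    (hT : ∀ k, ∑ i, T k i - 1 / 2 * ∑ i, (H k i * l i + p i * Λ k i) = B' * l k)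
    (hB : ∑ i, H i i - 1 / 2 * ∑ i, p i * l i = B) :
    2 / v ^ 2 * (B ^ 2 / n) + 2 * B' / v ^ 2 * ∑ i, p i * l i ≤
      ∑ i, Λ i i - (∑ i, ∑ j, p i * p j * Λ i j) / v ^ 2 := by
  have hn0 : (0 : ℝ) < n := by exact_mod_cast hn
  set P := ∑ i, p i ^ 2 with hP
  set A := ∑ i, ∑ k, H i k ^ 2 with hA
  set N := ∑ i, l i ^ 2 with hN
  set D := ∑ i, p i * l i with hD
  set q := ∑ i, ∑ j, p i * p j * Λ i j with hq
  have hP0 : 0 ≤ P := Finset.sum_nonneg fun i _ => sq_nonneg _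
  have h1 : 2 * A + 2 * ∑ i, ∑ k, p k * T k i = v ^ 2 * (N + ∑ i, Λ i i) := by
    have := Finset.sum_congr rfl fun i (_ : i ∈ Finset.univ) => hΛ i
    simpa only [Finset.sum_add_distrib, ← Finset.mul_sum] using this
  have h2 : ∑ k, ∑ i, p k * T k i - 1 / 2 * (v ^ 2 / 2 * N + q) = B' * D := by
    have := Finset.sum_congr rfl fun k (_ : k ∈ Finset.univ) =>
      congrArg (fun z => p k * z) (hT k)
    have hHl : ∑ k, ∑ i, p k * (H k i * l i) = v ^ 2 / 2 * N := by
      rw [Finset.sum_comm, hN, Finset.mul_sum]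
      refine Finset.sum_congr rfl fun i _ => ?_
      have := hl i
      calc ∑ k, p k * (H k i * l i) = (∑ k, p k * H i k) * l i := by
            rw [Finset.sum_mul]
            exact Finset.sum_congr rfl fun k _ => by rw [hH k i]; ring
        _ = _ := by linear_combination l i / 2 * this
    have hBl : ∑ k, p k * (B' * l k) = B' * D := by
      rw [hD, Finset.mul_sum]
      exact Finset.sum_congr rfl fun k _ => by ring
    rw [hBl] at this
    rw [← this, ← hHl, hq, ← Finset.sum_add_distrib, Finset.mul_sum, ← Finset.sum_sub_distrib]
    refine Finset.sum_congr rfl fun k _ => ?_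
    rw [← Finset.sum_add_distrib, mul_sub, mul_left_comm (p k),
      Finset.mul_sum _ _ (p k), Finset.mul_sum _ _ (p k)]
    congr 2
    exact Finset.sum_congr rfl fun i _ => by ring
  have h3 : B ^ 2 / n ≤ A - v ^ 2 / 4 * N := by
    set μ := B / n with hμ
    have hk (k : Fin n) : (v ^ 2 * l k / 2 - μ * p k) ^ 2 / v ^ 2 ≤
        ∑ i, H i k ^ 2 - 2 * μ * H k k + μ ^ 2 := by
      have h := sum_mul_sq_div_le p (fun i => H i k - μ * if i = k then 1 else 0) hv
      have e1 : ∑ i, p i * (H i k - μ * if i = k then 1 else 0) =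
          v ^ 2 * l k / 2 - μ * p k := by
        simp only [mul_sub, Finset.sum_sub_distrib]
        rw [← hl k]
        simp only [hH _ k]
        simp [mul_comm]
      have e2 : ∑ i, (H i k - μ * if i = k then 1 else 0) ^ 2 =
          ∑ i, H i k ^ 2 - 2 * μ * H k k + μ ^ 2 := by
        have (i : Fin n) : (H i k - μ * if i = k then 1 else 0) ^ 2 =
            H i k ^ 2 - (if i = k then 2 * μ * H i k else 0) + (if i = k then μ ^ 2 else 0) := by
          split_ifs <;> ring
        simp only [this, Finset.sum_add_distrib, Finset.sum_sub_distrib]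
        simp
      rwa [e1, e2] at h
    have hs := Finset.sum_le_sum fun k (_ : k ∈ Finset.univ) => hk k
    have e3 (k : Fin n) : (v ^ 2 * l k / 2 - μ * p k) ^ 2 / v ^ 2 =
        v ^ 2 / 4 * l k ^ 2 - μ * (p k * l k) + μ ^ 2 / v ^ 2 * p k ^ 2 := by
      field_simp
      ring
    simp only [e3, Finset.sum_add_distrib, Finset.sum_sub_distrib, ← Finset.mul_sum, ← hN, ← hD,
      ← hP] at hs
    rw [Finset.sum_comm, ← hA] at hs
    simp only [Finset.sum_const, Finset.card_univ, Fintype.card_fin, nsmul_eq_mul] at hs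
    have hpos : 0 ≤ μ ^ 2 / v ^ 2 * P := by positivity
    have e4 : B ^ 2 / n = 2 * μ * B - n * μ ^ 2 := by
      rw [hμ]; field_simp; ring
    have e5 : 2 * μ * B = 2 * μ * ∑ i, H i i - μ * D := by rw [← hB]; ring
    rw [e4]
    linarith
  rw [Finset.sum_comm] at h2
  have h4 : v ^ 2 * (∑ i, Λ i i - q / v ^ 2) = v ^ 2 * ∑ i, Λ i i - q := by
    field_simp
  have h5 : v ^ 2 * (2 / v ^ 2 * (B ^ 2 / n) + 2 * B' / v ^ 2 * D) =
      2 * (B ^ 2 / n) + 2 * B' * D := by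
    field_simp
  refine le_of_mul_le_mul_left ?_ (pow_pos hv0 2)
  rw [h4, h5]
  linarith

lemma maximum_point_inequality (hn : 1 ≤ n) (p l g : Fin n → ℝ) (H Λ T : Fin n → Fin n → ℝ)
    {v f ℓ θ κ k d : ℝ} (hv0 : 0 < v) (hv : v ^ 2 = 1 + ∑ i, p i ^ 2) (hℓ : 0 < ℓ)
    (hd : 0 ≤ d) (hk : 0 ≤ k) (hH : ∀ i j, H i j = H j i)
    (hl : ∀ i, 2 * ∑ k, p k * H i k = v ^ 2 * l i)
    (hΛ : ∀ i, 2 * ∑ k, H i k ^ 2 + 2 * ∑ k, p k * T k i = v ^ 2 * (l i ^ 2 + Λ i i))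
    (hT : ∀ k, ∑ i, T k i - 1 / 2 * ∑ i, (H k i * l i + p i * Λ k i) =
      v * f * (1 / 2 + θ / ℓ) * l k)
    (hB : ∑ i, H i i - 1 / 2 * ∑ i, p i * l i = v * f)
    (hcrit : ∀ i, l i = ℓ * (κ * p i - k * g i))
    (hmax : ∀ w : Fin n → ℝ, ∑ i, ∑ j, w i * w j * (Λ i j / ℓ - l i * l j / ℓ ^ 2 - κ * H i j -
      k * ((if i = j then d else 0) + g i * g j)) ≤ 0) :
    2 * f ^ 2 / (n * ℓ) + f / v * (1 + 2 * θ / ℓ) *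
        (κ * ∑ i, p i ^ 2 - k * ∑ i, p i * g i) - κ * (v * f) ≤
      2 * κ ^ 2 * (∑ i, p i ^ 2) / v ^ 2 + (2 * k ^ 2 + k) * ∑ i, g i ^ 2 + k * n * d := by
  have hn0 : (0 : ℝ) < n := by exact_mod_cast hn
  have hboch := bochner_lower_bound hn p l H Λ T hv0 hv hH hl hΛ hT hB
  have htr := trace_sub_div_nonpos p _ hv0 hv hmax
  set P := ∑ i, p i ^ 2 with hP
  set N := ∑ i, g i ^ 2 with hN
  set G := ∑ i, p i * g i with hG
  have hP0 : 0 ≤ P := Finset.sum_nonneg fun i _ => sq_nonneg _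
  have hpl : ∑ i, p i * l i = ℓ * (κ * P - k * G) := by
    simp only [hP, hG, Finset.mul_sum, ← Finset.sum_sub_distrib]
    exact Finset.sum_congr rfl fun i _ => by rw [hcrit]; ring
  have hll : ∑ i, l i * l i = ℓ ^ 2 * (κ ^ 2 * P - 2 * κ * k * G + k ^ 2 * N) := by
    simp only [hP, hG, hN, Finset.mul_sum, ← Finset.sum_sub_distrib, ← Finset.sum_add_distrib]
    exact Finset.sum_congr rfl fun i _ => by rw [hcrit]; ring
  have hpHp : ∑ i, ∑ j, p i * p j * H i j = v ^ 2 / 2 * ∑ i, p i * l i := by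
    rw [Finset.mul_sum]
    refine Finset.sum_congr rfl fun i _ => ?_
    have : ∑ j, p i * p j * H i j = p i * ∑ j, p j * H i j := by
      rw [Finset.mul_sum]; exact Finset.sum_congr rfl fun j _ => by ring
    rw [this]
    linear_combination p i / 2 * hl i
  have hsq (a : Fin n → ℝ) : ∑ i, ∑ j, p i * p j * (a i * a j) = (∑ i, p i * a i) ^ 2 := by
    rw [sq, Finset.sum_mul_sum]
    exact Finset.sum_congr rfl fun i _ => Finset.sum_congr rfl fun j _ => by ring
  have hdiag : ∑ i, ∑ j, p i * p j * (if i = j then d else 0) = d * P := by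
    simp only [mul_ite, mul_zero, Finset.sum_ite_eq, Finset.mem_univ, if_true, hP, Finset.mul_sum]
    exact Finset.sum_congr rfl fun i _ => by ring
  have e1 : ∑ i, (Λ i i / ℓ - l i * l i / ℓ ^ 2 - κ * H i i -
      k * ((if i = i then d else 0) + g i * g i)) =
      (∑ i, Λ i i) / ℓ - (∑ i, l i * l i) / ℓ ^ 2 - κ * ∑ i, H i i - k * (n * d + N) := by
    simp only [hN, if_true, Finset.sum_sub_distrib, ← Finset.mul_sum, ← Finset.sum_div,
      Finset.sum_add_distrib, ← sq]
    simp
  have e2 : ∑ i, ∑ j, p i * p j * (Λ i j / ℓ - l i * l j / ℓ ^ 2 - κ * H i j -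
      k * ((if i = j then d else 0) + g i * g j)) =
      (∑ i, ∑ j, p i * p j * Λ i j) / ℓ - (∑ i, p i * l i) ^ 2 / ℓ ^ 2 -
        κ * (v ^ 2 / 2 * ∑ i, p i * l i) - k * (d * P + G ^ 2) := by
    rw [← hpHp, ← hsq l, ← hsq g, ← hdiag]
    simp only [Finset.sum_div, Finset.mul_sum, ← Finset.sum_sub_distrib,
      ← Finset.sum_add_distrib]
    exact Finset.sum_congr rfl fun i _ => Finset.sum_congr rfl fun j _ => by ring
  rw [e1, e2] at htr
  have hGN : G ^ 2 / v ^ 2 ≤ N := sum_mul_sq_div_le p g hv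
  set Λt := ∑ i, Λ i i
  set Λq := ∑ i, ∑ j, p i * p j * Λ i j
  set Ht := ∑ i, H i i
  rw [hpl] at hB hboch htr
  rw [hll] at htr
  have hboch' := div_le_div_of_nonneg_right hboch hℓ.le
  have e3 : (2 / v ^ 2 * ((v * f) ^ 2 / n) +
      2 * (v * f * (1 / 2 + θ / ℓ)) / v ^ 2 * (ℓ * (κ * P - k * G))) / ℓ =
      2 * f ^ 2 / (n * ℓ) + f / v * (1 + 2 * θ / ℓ) * (κ * P - k * G) := by
    field_simp
  have e4 : (Λt - Λq / v ^ 2) / ℓ = (Λt / ℓ - Λq / ℓ / v ^ 2) := by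
    field_simp
  rw [e3, e4] at hboch'
  have e5 : Ht = v * f + 1 / 2 * (ℓ * (κ * P - k * G)) := by linarith
  rw [e5] at htr
  have e6 : (Λq / ℓ - (ℓ * (κ * P - k * G)) ^ 2 / ℓ ^ 2 -
      κ * (v ^ 2 / 2 * (ℓ * (κ * P - k * G))) - k * (d * P + G ^ 2)) / v ^ 2 =
      Λq / ℓ / v ^ 2 - (κ * P - k * G) ^ 2 / v ^ 2 - κ * (1 / 2 * (ℓ * (κ * P - k * G))) -
        k * (d * P + G ^ 2) / v ^ 2 := by
    field_simp
  have e7 : ℓ ^ 2 * (κ ^ 2 * P - 2 * κ * k * G + k ^ 2 * N) / ℓ ^ 2 =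
      κ ^ 2 * P - 2 * κ * k * G + k ^ 2 * N := by
    field_simp
  rw [e6, e7] at htr
  have h1 : 0 ≤ k * (d * P + G ^ 2) / v ^ 2 := by positivity
  have hPv : P / v ^ 2 = P - P ^ 2 / v ^ 2 := by
    rw [show P = v ^ 2 - 1 by linarith]
    field_simp
    ring
  have h2 : κ ^ 2 * P - 2 * κ * k * G + k ^ 2 * N - (κ * P - k * G) ^ 2 / v ^ 2 ≤
      2 * κ ^ 2 * P / v ^ 2 + 2 * k ^ 2 * N := by
    have h3 : 0 ≤ (∑ i, (κ * p i + k * g i) ^ 2) -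
        (∑ i, p i * (κ * p i + k * g i)) ^ 2 / v ^ 2 :=
      sub_nonneg.2 (sum_mul_sq_div_le p _ hv)
    have e8 : ∑ i, (κ * p i + k * g i) ^ 2 = κ ^ 2 * P + 2 * κ * k * G + k ^ 2 * N := by
      simp only [hP, hG, hN, Finset.mul_sum, ← Finset.sum_add_distrib]
      exact Finset.sum_congr rfl fun i _ => by ring
    have e9 : ∑ i, p i * (κ * p i + k * g i) = κ * P + k * G := by
      simp only [hP, hG, Finset.mul_sum, ← Finset.sum_add_distrib]
      exact Finset.sum_congr rfl fun i _ => by ring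
    rw [e8, e9] at h3
    have e10 : (κ * P - k * G) ^ 2 / v ^ 2 =
        2 * κ ^ 2 * (P ^ 2 / v ^ 2) + 2 * k ^ 2 * (G ^ 2 / v ^ 2) -
          (κ * P + k * G) ^ 2 / v ^ 2 := by
      field_simp
      ring
    have e11 : 2 * κ ^ 2 * P / v ^ 2 = 2 * κ ^ 2 * (P - P ^ 2 / v ^ 2) := by
      rw [← hPv]; ring
    have h4 : 0 ≤ 2 * k ^ 2 * (G ^ 2 / v ^ 2) := by positivity
    rw [e10, e11]
    linarith
  linarith

end LinearAlgebra

section ScalarEstimate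

lemma one_sub_exp_neg_mul_sq_le {ℓ θ : ℝ} (hℓ : 0 < ℓ) (hθ0 : 0 < θ) (hθ1 : θ ≤ 1) :
    ℓ * (1 + 2 * θ / ℓ) ^ 2 * ((exp ℓ - 1) / exp ℓ) ≤ 9 * (1 + ℓ) := by
  have he := exp_pos ℓ
  have hs1 : (exp ℓ - 1) / exp ℓ ≤ 1 := by rw [div_le_one he]; linarith
  have hs2 : (exp ℓ - 1) / exp ℓ ≤ ℓ := by
    have : (exp ℓ - 1) / exp ℓ = 1 - exp (-ℓ) := by rw [exp_neg]; field_simp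
    rw [this]
    linarith [add_one_le_exp (-ℓ)]
  have hs0 : 0 ≤ (exp ℓ - 1) / exp ℓ :=
    div_nonneg (by linarith [add_one_le_exp ℓ]) he.le
  set s := (exp ℓ - 1) / exp ℓ
  have h1 : ℓ * (1 + 2 * θ / ℓ) ^ 2 * s = (ℓ + 2 * θ) ^ 2 * s / ℓ := by field_simp
  have h2 : (ℓ + 2 * θ) ^ 2 ≤ (ℓ + 2) ^ 2 := by gcongr; linarith
  rw [h1, div_le_iff₀ hℓ]
  rcases le_total ℓ 1 with h | h
  · have h3 : (ℓ + 2) ^ 2 ≤ 9 := by nlinarith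
    nlinarith [mul_le_mul (h2.trans h3) hs2 hs0 (by norm_num)]
  · nlinarith [mul_le_mul h2 hs1 hs0 (by positivity)]

lemma pow_three_le_exp_sub_one_div {ℓ : ℝ} (hℓ : 1 ≤ ℓ) :
    ℓ ^ 3 / 96 ≤ (exp ℓ - 1) / exp (ℓ / 2) := by
  have h1 := Real.pow_div_factorial_le_exp (ℓ / 2) (by linarith) 3
  have h2 : exp ℓ = exp (ℓ / 2) * exp (ℓ / 2) := by rw [← Real.exp_add]; ring_nf
  have h3 : 2 ≤ exp ℓ := by linarith [add_one_le_exp ℓ]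
  have hv := exp_pos (ℓ / 2)
  rw [le_div_iff₀ hv]
  norm_num [Nat.factorial] at h1
  nlinarith [mul_le_mul_of_nonneg_right h1 hv.le]

set_option maxHeartbeats 1000000 in
lemma scalar_inequality_false {n : ℕ} (hn : 1 ≤ n) {θ m k ε δ C : ℝ} (hθ0 : 0 < θ) (hθ1 : θ ≤ 1)
    (hm : 0 < m) (hk : 0 ≤ k) (hε1 : ε ≤ 1) (hεm : ε ≤ m / (4 * n)) (hεθ : ε ≤ θ * m / 4)
    (hC : C = 18 * n * k ^ 2 + 4 * (2 * k ^ 2 + k) + 2 * k * n)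
    (hC0 : 0 < C) (hδm : 2 * C * δ < m ^ 2 / n) (hδθ : 2 * C * δ < θ * m / 96)
    {ℓ a κ ρ P v f G N d : ℝ} (hℓ : 0 < ℓ) (ha1 : ℓ ≤ 1 → ℓ ≤ a) (ha2 : 1 ≤ ℓ → 1 ≤ a ∧ a ≤ ℓ)
    (hκ0 : 0 < κ) (hκ : κ ≤ ε) (hρ : ρ ≤ δ * κ * a ^ 2) (hP : P = exp ℓ - 1)
    (hv : v = exp (ℓ / 2)) (hf : f = m * a) (hN : N ≤ 4 * ρ) (hG : G ^ 2 ≤ P * N)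
    (hd : d ≤ 2 * ρ)
    (hmain : 2 * f ^ 2 / (n * ℓ) + f / v * (1 + 2 * θ / ℓ) * (κ * P - k * G) - κ * (v * f) ≤
      2 * κ ^ 2 * P / v ^ 2 + (2 * k ^ 2 + k) * N + k * n * d) : False := by
  have hn0 : (0 : ℝ) < n := by exact_mod_cast hn
  have hv0 : 0 < v := hv ▸ exp_pos _
  have hv2 : v ^ 2 = exp ℓ := by rw [hv, ← Real.exp_nat_mul]; congr 1; push_cast; ring
  have hPv : P = v ^ 2 - 1 := by rw [hP, hv2]
  have hP0 : 0 < P := by rw [hP]; linarith [add_one_le_exp ℓ]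
  have ha0 : 0 < a := by
    rcases le_total ℓ 1 with h | h
    · linarith [ha1 h]
    · linarith [(ha2 h).1]
  have hf0 : 0 < f := hf ▸ mul_pos hm ha0
  have hav : ℓ / 2 ≤ a * v := by
    have h1 : ℓ / 2 + 1 ≤ v := hv ▸ add_one_le_exp _
    rcases le_total ℓ 1 with h | h
    · nlinarith [ha1 h]
    · nlinarith [(ha2 h).1]
  have hfv : m / 2 ≤ f * v / ℓ := by
    rw [le_div_iff₀ hℓ, hf]
    nlinarith
  have hG4 : G ^ 2 ≤ 4 * P * ρ := hG.trans (by nlinarith)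
  have hρ0 : 0 ≤ ρ := by nlinarith [sq_nonneg G]
  have h1 : f / v * (1 + 2 * θ / ℓ) * (k * G) ≤
      f ^ 2 / (2 * n * ℓ) + 18 * n * k ^ 2 * ρ * (1 + ℓ) := by
    have e1 : f / v * (1 + 2 * θ / ℓ) * (k * G) ≤ f ^ 2 / (2 * n * ℓ) +
        n * ℓ / 2 * ((1 + 2 * θ / ℓ) * (k * G) / v) ^ 2 := by
      have : 0 ≤ (f / (n * ℓ) - (1 + 2 * θ / ℓ) * (k * G) / v) ^ 2 * (n * ℓ / 2) := by positivity
      have e2 : (f / (n * ℓ) - (1 + 2 * θ / ℓ) * (k * G) / v) ^ 2 * (n * ℓ / 2) =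
          f ^ 2 / (2 * n * ℓ) + n * ℓ / 2 * ((1 + 2 * θ / ℓ) * (k * G) / v) ^ 2 -
            f / v * (1 + 2 * θ / ℓ) * (k * G) := by
        field_simp
        ring
      linarith
    have e3 : n * ℓ / 2 * ((1 + 2 * θ / ℓ) * (k * G) / v) ^ 2 =
        n * k ^ 2 / 2 * (ℓ * (1 + 2 * θ / ℓ) ^ 2) / v ^ 2 * G ^ 2 := by
      ring
    have e4 : n * k ^ 2 / 2 * (ℓ * (1 + 2 * θ / ℓ) ^ 2) / v ^ 2 * G ^ 2 ≤
        n * k ^ 2 / 2 * (ℓ * (1 + 2 * θ / ℓ) ^ 2) / v ^ 2 * (4 * P * ρ) := by gcongr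
    have e5 := one_sub_exp_neg_mul_sq_le hℓ hθ0 hθ1
    rw [← hv2, ← hPv] at e5
    have e6 : n * k ^ 2 / 2 * (ℓ * (1 + 2 * θ / ℓ) ^ 2) / v ^ 2 * (4 * P * ρ) =
        2 * n * k ^ 2 * ρ * (ℓ * (1 + 2 * θ / ℓ) ^ 2 * (P / v ^ 2)) := by ring
    have e7 := mul_le_mul_of_nonneg_left e5 (by positivity : 0 ≤ 2 * n * k ^ 2 * ρ)
    linarith
  have h2 : f / v * (1 + 2 * θ / ℓ) * (κ * P) - κ * (v * f) =
      2 * (θ * κ * f * P / (v * ℓ)) - κ * f / v := by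
    rw [hPv]
    field_simp
    ring
  have h3 : κ * f / v ≤ f ^ 2 / (2 * n * ℓ) := by
    have e1 : f ^ 2 / (2 * n * ℓ) = f / v * (f * v / ℓ / (2 * n)) := by field_simp
    have e2 : κ ≤ f * v / ℓ / (2 * n) := by
      rw [le_div_iff₀ (by positivity)]
      have := hκ.trans hεm
      rw [le_div_iff₀ (by positivity)] at this
      linarith
    rw [e1, show κ * f / v = f / v * κ by ring]
    gcongr
  have h4 : 2 * κ ^ 2 * P / v ^ 2 ≤ θ * κ * f * P / (v * ℓ) := by
    have e1 : θ * κ * f * P / (v * ℓ) = κ * P / v ^ 2 * (θ * (f * v / ℓ)) := by field_simp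
    have e2 : 2 * κ ≤ θ * (f * v / ℓ) := by nlinarith
    rw [e1, show 2 * κ ^ 2 * P / v ^ 2 = κ * P / v ^ 2 * (2 * κ) by ring]
    gcongr
  have h5 : (2 * k ^ 2 + k) * N + k * n * d ≤
      (4 * (2 * k ^ 2 + k) + 2 * k * n) * ρ * (1 + ℓ) := by
    have e1 : (2 * k ^ 2 + k) * N ≤ (2 * k ^ 2 + k) * (4 * ρ) := by gcongr
    have e2 : k * n * d ≤ k * n * (2 * ρ) := by gcongr
    have e3 : 0 ≤ (4 * (2 * k ^ 2 + k) + 2 * k * n) * ρ * ℓ := by positivity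
    linarith
  have h6 : f ^ 2 / (n * ℓ) + θ * κ * f * P / (v * ℓ) ≤ C * (1 + ℓ) * ρ := by
    have e1 : 2 * f ^ 2 / (n * ℓ) = 2 * (f ^ 2 / (n * ℓ)) := by ring
    have e2 : f ^ 2 / (2 * n * ℓ) = f ^ 2 / (n * ℓ) / 2 := by field_simp
    rw [mul_sub, e1] at hmain
    rw [e2] at h1 h3
    rw [hC]
    linarith
  have h7 : C * (1 + ℓ) * ρ ≤ C * (1 + ℓ) * (δ * κ * a ^ 2) := by gcongr
  have hA1 : 0 < f ^ 2 / (n * ℓ) := by positivity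
  have hA2 : 0 < θ * κ * f * P / (v * ℓ) := by positivity
  have hδ0 : 0 ≤ δ := by
    by_contra! hneg
    have : δ * κ * a ^ 2 < 0 := mul_neg_of_neg_of_pos (mul_neg_of_neg_of_pos hneg hκ0) (by positivity)
    linarith
  rcases le_total ℓ 1 with h | h
  · have e1 : C * (1 + ℓ) * (δ * κ * a ^ 2) ≤ C * (1 + 1) * (δ * 1 * a ^ 2) := by
      gcongr
      linarith
    have e2 : m ^ 2 / n * a ^ 2 ≤ f ^ 2 / (n * ℓ) := by
      rw [hf, show m ^ 2 / n * a ^ 2 = (m * a) ^ 2 / (n * 1) by ring]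
      gcongr
    have e3 : 2 * C * δ * a ^ 2 < m ^ 2 / n * a ^ 2 := by gcongr
    linarith
  · obtain ⟨h1a, haℓ⟩ := ha2 h
    have e1 : C * (1 + ℓ) * (δ * κ * a ^ 2) ≤ C * (ℓ + ℓ) * (δ * κ * (a * ℓ)) := by
      rw [sq]
      gcongr
    have e2 := pow_three_le_exp_sub_one_div h
    rw [← hP, ← hv] at e2
    have e3 : θ * κ * (m * a) * (ℓ ^ 3 / 96) / ℓ ≤ θ * κ * f * P / (v * ℓ) := by
      rw [hf, show θ * κ * (m * a) * P / (v * ℓ) = θ * κ * (m * a) * (P / v) / ℓ by field_simp]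
      gcongr
    have e4 : θ * κ * (m * a) * (ℓ ^ 3 / 96) / ℓ = θ * m / 96 * (κ * a * ℓ ^ 2) := by field_simp
    have e5 : 2 * C * δ * (κ * a * ℓ ^ 2) < θ * m / 96 * (κ * a * ℓ ^ 2) := by gcongr
    linarith

end ScalarEstimate

section Bernstein

open Topology

variable {n : ℕ} {u g : EuclideanSpace ℝ (Fin n) → ℝ} {x : EuclideanSpace ℝ (Fin n)}

lemma pd1_log (hg : DifferentiableAt ℝ g x) (h0 : g x ≠ 0) (i : Fin n) :
    pd1 (fun y => log (g y)) i x = pd1 g i x / g x := by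
  rw [pd1_comp (Real.hasDerivAt_log h0) hg]
  field_simp

lemma pd1_pd1_log (hg : ContDiffAt ℝ 2 g x) (h0 : g x ≠ 0) (i j : Fin n) :
    pd1 (pd1 (fun y => log (g y)) j) i x =
      pd1 (pd1 g j) i x / g x - pd1 g i x * pd1 g j x / g x ^ 2 := by
  have hev : pd1 (fun y => log (g y)) j =ᶠ[𝓝 x] fun y => pd1 g j y * (g y)⁻¹ := by
    filter_upwards [hg.eventually (by simp), hg.continuousAt.eventually_ne h0] with y hy hy0
    rw [pd1_log (hy.differentiableAt (by norm_num)) hy0, div_eq_mul_inv]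
  have hd := hg.differentiableAt (by norm_num)
  have hinv : DifferentiableAt ℝ (fun y => (g y)⁻¹) x := hd.fun_inv h0
  rw [pd1_congr hev, pd1_fun_mul ((contDiffAt_pd1 hg (m := 1) (by norm_num) j).differentiableAt
    (by norm_num)) hinv, pd1_comp (φ := fun t => t⁻¹) (hasDerivAt_inv h0) hd]
  field_simp
  ring

/-- The quantity `log (1 + |∇u|²)`. -/
noncomputable def logGrad (u : EuclideanSpace ℝ (Fin n) → ℝ) (y : EuclideanSpace ℝ (Fin n)) : ℝ :=
  log (1 + ∑ i, pd1 u i y ^ 2)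

lemma one_add_sum_sq_pos (p : Fin n → ℝ) : 0 < 1 + ∑ i, p i ^ 2 := by
  have : 0 ≤ ∑ i, p i ^ 2 := Finset.sum_nonneg fun i _ => sq_nonneg _
  linarith

lemma exp_logGrad : exp (logGrad u x) = 1 + ∑ i, pd1 u i x ^ 2 :=
  exp_log (one_add_sum_sq_pos _)

lemma contDiffAt_one_add_sum {m k : WithTop ℕ∞} (hu : ContDiffAt ℝ k u x) (hmk : m + 1 ≤ k) :
    ContDiffAt ℝ m (fun y => 1 + ∑ i, pd1 u i y ^ 2) x :=
  contDiffAt_const.add (ContDiffAt.sum fun i _ => (contDiffAt_pd1 hu hmk i).pow 2)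

lemma contDiffAt_logGrad {m k : WithTop ℕ∞} (hu : ContDiffAt ℝ k u x) (hmk : m + 1 ≤ k) :
    ContDiffAt ℝ m (logGrad u) x :=
  (contDiffAt_one_add_sum hu hmk).log (one_add_sum_sq_pos _).ne'

lemma pd1_one_add_sum (hu : ContDiffAt ℝ 2 u x) (i : Fin n) :
    pd1 (fun y => 1 + ∑ k, pd1 u k y ^ 2) i x =
      2 * ∑ k, pd1 u k x * pd1 (pd1 u k) i x := by
  have hd (k : Fin n) : DifferentiableAt ℝ (pd1 u k) x :=
    (contDiffAt_pd1 hu (m := 1) (by norm_num) k).differentiableAt (by norm_num)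
  rw [pd1_const_add, pd1_fun_sum fun k _ => (hd k).fun_pow 2, Finset.mul_sum]
  refine Finset.sum_congr rfl fun k _ => ?_
  simp only [sq]
  rw [pd1_fun_mul (hd k) (hd k)]
  ring

lemma two_mul_sum_eq_pd1_logGrad (hu : ContDiffAt ℝ 2 u x) (i : Fin n) :
    2 * ∑ k, pd1 u k x * pd1 (pd1 u k) i x =
      (1 + ∑ k, pd1 u k x ^ 2) * pd1 (logGrad u) i x := by
  have hpos := one_add_sum_sq_pos fun k => pd1 u k x
  have := pd1_log ((contDiffAt_one_add_sum (m := 1) hu (by norm_num)).differentiableAt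
    (by norm_num)) hpos.ne' i
  rw [show logGrad u = fun y => log (1 + ∑ k, pd1 u k y ^ 2) from rfl, this, pd1_one_add_sum hu]
  field_simp

lemma mcOp_eq (hu : ContDiffAt ℝ 2 u x) :
    mcOp u x = ∑ i, pd1 (pd1 u i) i x - 1 / 2 * ∑ i, pd1 u i x * pd1 (logGrad u) i x := by
  have hpos := one_add_sum_sq_pos fun k => pd1 u k x
  rw [mcOp, Finset.mul_sum, ← Finset.sum_sub_distrib]
  refine Finset.sum_congr rfl fun i _ => ?_
  have h1 (j : Fin n) : aCoef u i j x * pd2 u i j x = (if i = j then pd1 (pd1 u j) i x else 0) -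
      pd1 u i x / (1 + ∑ k, pd1 u k x ^ 2) * (pd1 u j x * pd1 (pd1 u j) i x) := by
    rw [aCoef, norm_gradient_sq, show pd2 u i j x = pd1 (pd1 u j) i x from rfl]
    split_ifs <;> ring
  simp only [h1, Finset.sum_sub_distrib, ← Finset.mul_sum]
  have h2 := two_mul_sum_eq_pd1_logGrad hu i
  have h3 : ∑ k, pd1 u k x * pd1 (pd1 u k) i x =
      (1 + ∑ k, pd1 u k x ^ 2) * pd1 (logGrad u) i x / 2 := by linarith
  rw [h3]
  simp only [Finset.sum_ite_eq, Finset.mem_univ, if_true]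
  field_simp

lemma laplacian_logGrad_identity (hu : ContDiffAt ℝ 3 u x) (i : Fin n) :
    2 * ∑ k, pd1 (pd1 u k) i x ^ 2 + 2 * ∑ k, pd1 u k x * pd1 (pd1 (pd1 u i) i) k x =
      (1 + ∑ k, pd1 u k x ^ 2) *
        (pd1 (logGrad u) i x ^ 2 + pd1 (pd1 (logGrad u) i) i x) := by
  have hu2 : ContDiffAt ℝ 2 u x := hu.of_le (by norm_num)
  have hev : (fun y => 2 * ∑ k, pd1 u k y * pd1 (pd1 u k) i y) =ᶠ[𝓝 x]
      fun y => (1 + ∑ k, pd1 u k y ^ 2) * pd1 (logGrad u) i y := by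
    filter_upwards [hu2.eventually (by simp)] with y hy using two_mul_sum_eq_pd1_logGrad hy i
  have hp (k : Fin n) : ContDiffAt ℝ 2 (pd1 u k) x := contDiffAt_pd1 hu (by norm_num) k
  have hpp (k : Fin n) : DifferentiableAt ℝ (pd1 (pd1 u k) i) x :=
    (contDiffAt_pd1 (hp k) (m := 1) (by norm_num) i).differentiableAt (by norm_num)
  have hp' (k : Fin n) : DifferentiableAt ℝ (pd1 u k) x := (hp k).differentiableAt (by norm_num)
  have hthird (k : Fin n) : pd1 (pd1 (pd1 u k) i) i x = pd1 (pd1 (pd1 u i) i) k x := by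
    have h1 : pd1 (pd1 u k) i =ᶠ[𝓝 x] pd1 (pd1 u i) k := by
      filter_upwards [hu2.eventually (by simp)] with y hy using pd1_pd1_comm hy i k
    rw [pd1_congr h1, pd1_pd1_comm (hp i)]
  have h := pd1_congr hev i
  rw [pd1_const_mul (DifferentiableAt.fun_sum fun k _ => (hp' k).fun_mul (hpp k)),
    pd1_fun_sum fun k _ => (hp' k).fun_mul (hpp k),
    pd1_fun_mul ((contDiffAt_one_add_sum (m := 1) hu (by norm_num)).differentiableAt
      (by norm_num)) ((contDiffAt_pd1 (contDiffAt_logGrad (m := 2) hu (by norm_num)) (m := 1)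
      (by norm_num) i).differentiableAt (by norm_num)),
    pd1_one_add_sum hu2, two_mul_sum_eq_pd1_logGrad hu2] at h
  have h2 : ∑ k, pd1 (fun y => pd1 u k y * pd1 (pd1 u k) i y) i x =
      ∑ k, pd1 u k x * pd1 (pd1 (pd1 u i) i) k x + ∑ k, pd1 (pd1 u k) i x ^ 2 := by
    rw [← Finset.sum_add_distrib]
    refine Finset.sum_congr rfl fun k _ => ?_
    rw [pd1_fun_mul (hp' k) (hpp k), hthird, sq]
  rw [h2] at h
  linear_combination h

lemma differentiated_equation {F : ℝ → ℝ} {F' : ℝ} (hu : ContDiffAt ℝ 3 u x)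
    (hF : HasDerivAt F F' (logGrad u x)) (heq : ∀ᶠ y in 𝓝 x, mcOp u y = F (logGrad u y))
    (k : Fin n) :
    ∑ i, pd1 (pd1 (pd1 u i) i) k x - 1 / 2 * ∑ i, (pd1 (pd1 u i) k x * pd1 (logGrad u) i x +
      pd1 u i x * pd1 (pd1 (logGrad u) i) k x) = F' * pd1 (logGrad u) k x := by
  have hu2 : ContDiffAt ℝ 2 u x := hu.of_le (by norm_num)
  have hev : (fun y => ∑ i, pd1 (pd1 u i) i y - 1 / 2 * ∑ i, pd1 u i y * pd1 (logGrad u) i y)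
      =ᶠ[𝓝 x] fun y => F (logGrad u y) := by
    filter_upwards [hu2.eventually (by simp), heq] with y hy hy'
    rw [← hy', mcOp_eq hy]
  have hℓ : ContDiffAt ℝ 2 (logGrad u) x := contDiffAt_logGrad hu (by norm_num)
  have hℓ' (i : Fin n) : DifferentiableAt ℝ (pd1 (logGrad u) i) x :=
    (contDiffAt_pd1 hℓ (m := 1) (by norm_num) i).differentiableAt (by norm_num)
  have hp (i : Fin n) : ContDiffAt ℝ 2 (pd1 u i) x := contDiffAt_pd1 hu (by norm_num) i
  have hp' (i : Fin n) : DifferentiableAt ℝ (pd1 u i) x := (hp i).differentiableAt (by norm_num)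
  have hpp (i : Fin n) : DifferentiableAt ℝ (pd1 (pd1 u i) i) x :=
    (contDiffAt_pd1 (hp i) (m := 1) (by norm_num) i).differentiableAt (by norm_num)
  have hs : DifferentiableAt ℝ (fun y => ∑ i, pd1 u i y * pd1 (logGrad u) i y) x :=
    DifferentiableAt.fun_sum fun i _ => (hp' i).fun_mul (hℓ' i)
  have h := pd1_congr hev k
  rw [pd1_comp hF (hℓ.differentiableAt (by norm_num)),
    pd1_fun_sub (DifferentiableAt.fun_sum fun i _ => hpp i) (hs.const_mul _),
    pd1_fun_sum fun i _ => hpp i, pd1_const_mul hs,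
    pd1_fun_sum fun i _ => (hp' i).fun_mul (hℓ' i)] at h
  rw [← h]
  congr 2
  refine Finset.sum_congr rfl fun i _ => ?_
  rw [pd1_fun_mul (hp' i) (hℓ' i)]
  ring

/-- The cutoff `1 - |y|² / R²`. -/
noncomputable def cutoff (R : ℝ) (y : EuclideanSpace ℝ (Fin n)) : ℝ :=
  1 - ‖y‖ ^ 2 / R ^ 2

lemma contDiff_cutoff (R : ℝ) {k : WithTop ℕ∞} : ContDiff ℝ k (cutoff (n := n) R) :=
  contDiff_const.sub ((contDiff_norm_sq ℝ).div_const _)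

lemma pd1_cutoff (R : ℝ) (i : Fin n) : pd1 (cutoff R) i = fun y => -2 / R ^ 2 * y i := by
  ext y
  have h1 : cutoff (n := n) R = fun y => 1 + (-1 / R ^ 2) * ∑ j, y j * y j := by
    ext y
    rw [cutoff, EuclideanSpace.real_norm_sq_eq]
    simp only [sq]
    ring
  have hc (j : Fin n) : DifferentiableAt ℝ (fun y : EuclideanSpace ℝ (Fin n) => y j) y := by
    fun_prop
  rw [h1, pd1_const_add, pd1_const_mul (DifferentiableAt.fun_sum fun j _ => (hc j).fun_mul (hc j)),
    pd1_fun_sum fun j _ => (hc j).fun_mul (hc j)]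
  have h2 (j : Fin n) : pd1 (fun y : EuclideanSpace ℝ (Fin n) => y j * y j) i y =
      if i = j then 2 * y j else 0 := by
    rw [pd1_fun_mul (hc j) (hc j), pd1_coord]
    split_ifs <;> ring
  simp only [h2, Finset.sum_ite_eq, Finset.mem_univ, if_true]
  ring

lemma pd1_pd1_cutoff (R : ℝ) (i j : Fin n) :
    pd1 (pd1 (cutoff R) j) i x = if i = j then -2 / R ^ 2 else 0 := by
  rw [pd1_cutoff, pd1_const_mul (by fun_prop), pd1_coord]
  simp

lemma hasDerivAt_exp_half_mul_rpow (m θ : ℝ) {t : ℝ} (ht : 0 < t) :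
    HasDerivAt (fun t => exp (t / 2) * (m * t ^ θ))
      (exp (t / 2) * (m * t ^ θ) * (1 / 2 + θ / t)) t := by
  have h := (((hasDerivAt_id' t).div_const 2).exp).fun_mul
    ((Real.hasDerivAt_rpow_const (p := θ) (Or.inl ht.ne')).const_mul m)
  refine h.congr_deriv ?_
  rw [Real.rpow_sub_one ht.ne']
  field_simp

lemma inequality_at_local_max (hn : 1 ≤ n) {θ m k κ R : ℝ} (hk : 0 ≤ k) (hR : 0 < R)
    (hx : ‖x‖ < R) (hu : ContDiffAt ℝ 3 u x) (hℓ : 0 < logGrad u x)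
    (heq : ∀ᶠ y in 𝓝 x, mcOp u y = exp (logGrad u y / 2) * (m * logGrad u y ^ θ))
    (hmax : IsLocalMax (fun y => log (logGrad u y) + k * log (cutoff R y) - κ * u y) x) :
    ∃ G N d : ℝ, N ≤ 4 * (1 / (R * cutoff R x) ^ 2) ∧ G ^ 2 ≤ (exp (logGrad u x) - 1) * N ∧
      d ≤ 2 * (1 / (R * cutoff R x) ^ 2) ∧
      2 * (m * logGrad u x ^ θ) ^ 2 / (n * logGrad u x) +
        m * logGrad u x ^ θ / exp (logGrad u x / 2) * (1 + 2 * θ / logGrad u x) *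
          (κ * (exp (logGrad u x) - 1) - k * G) -
        κ * (exp (logGrad u x / 2) * (m * logGrad u x ^ θ)) ≤
      2 * κ ^ 2 * (exp (logGrad u x) - 1) / exp (logGrad u x / 2) ^ 2 +
        (2 * k ^ 2 + k) * N + k * n * d := by
  have hP : ∑ i, pd1 u i x ^ 2 = exp (logGrad u x) - 1 := by rw [exp_logGrad]; ring
  have hσ0 : 0 < cutoff R x := by
    rw [cutoff, sub_pos, div_lt_one (by positivity)]
    gcongr
  have hσ1 : cutoff R x ≤ 1 := by
    rw [cutoff]
    have : 0 ≤ ‖x‖ ^ 2 / R ^ 2 := by positivity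
    linarith
  have hv : exp (logGrad u x / 2) ^ 2 = 1 + ∑ i, pd1 u i x ^ 2 := by
    rw [← exp_logGrad, ← Real.exp_nat_mul]
    congr 1
    push_cast
    ring
  have hℓ2 : ContDiffAt ℝ 2 (logGrad u) x := contDiffAt_logGrad hu (by norm_num)
  have hu2 : ContDiffAt ℝ 2 u x := hu.of_le (by norm_num)
  have hσ2 : ContDiffAt ℝ 2 (cutoff R) x := (contDiff_cutoff R).contDiffAt
  have hlogℓ : ContDiffAt ℝ 2 (fun y => log (logGrad u y)) x := hℓ2.log hℓ.ne'
  have hlogσ : ContDiffAt ℝ 2 (fun y => log (cutoff R y)) x := hσ2.log hσ0.ne'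
  have hΦ : ContDiffAt ℝ 2 (fun y => log (logGrad u y) + k * log (cutoff R y) - κ * u y) x :=
    (hlogℓ.add (contDiffAt_const.mul hlogσ)).sub (contDiffAt_const.mul hu2)
  have hfirst {y : EuclideanSpace ℝ (Fin n)}
      (h1 : DifferentiableAt ℝ (fun y => log (logGrad u y)) y)
      (h2 : DifferentiableAt ℝ (fun y => log (cutoff R y)) y) (h3 : DifferentiableAt ℝ u y)
      (i : Fin n) : pd1 (fun y => log (logGrad u y) + k * log (cutoff R y) - κ * u y) i y =
        pd1 (fun y => log (logGrad u y)) i y + k * pd1 (fun y => log (cutoff R y)) i y -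
          κ * pd1 u i y := by
    rw [pd1_fun_sub (h1.fun_add (h2.const_mul k)) (h3.const_mul κ), pd1_fun_add h1 (h2.const_mul k),
      pd1_const_mul h2, pd1_const_mul h3]
  have hsecond (i j : Fin n) :
      pd1 (pd1 (fun y => log (logGrad u y) + k * log (cutoff R y) - κ * u y) j) i x =
        pd1 (pd1 (fun y => log (logGrad u y)) j) i x +
          k * pd1 (pd1 (fun y => log (cutoff R y)) j) i x - κ * pd1 (pd1 u j) i x := by
    have hev : pd1 (fun y => log (logGrad u y) + k * log (cutoff R y) - κ * u y) j =ᶠ[𝓝 x]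
        fun y => pd1 (fun y => log (logGrad u y)) j y +
          k * pd1 (fun y => log (cutoff R y)) j y - κ * pd1 u j y := by
      filter_upwards [hlogℓ.eventually (by simp), hlogσ.eventually (by simp),
        hu2.eventually (by simp)] with y h1 h2 h3
      exact hfirst (h1.differentiableAt (by norm_num)) (h2.differentiableAt (by norm_num))
        (h3.differentiableAt (by norm_num)) j
    have hD {g : EuclideanSpace ℝ (Fin n) → ℝ} (hg : ContDiffAt ℝ 2 g x) :
        DifferentiableAt ℝ (pd1 g j) x :=
      (contDiffAt_pd1 hg (m := 1) (by norm_num) j).differentiableAt (by norm_num)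
    rw [pd1_congr hev, pd1_fun_sub ((hD hlogℓ).fun_add ((hD hlogσ).const_mul k))
      ((hD hu2).const_mul κ), pd1_fun_add (hD hlogℓ) ((hD hlogσ).const_mul k),
      pd1_const_mul (hD hlogσ), pd1_const_mul (hD hu2)]
  have heqx := heq.self_of_nhds
  rw [mcOp_eq hu2] at heqx
  have hmain := maximum_point_inequality hn (fun i => pd1 u i x) (fun i => pd1 (logGrad u) i x)
    (fun i => pd1 (cutoff R) i x / cutoff R x) (fun i j => pd1 (pd1 u j) i x)
    (fun i j => pd1 (pd1 (logGrad u) j) i x) (fun k i => pd1 (pd1 (pd1 u i) i) k x)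
    (v := exp (logGrad u x / 2)) (f := m * logGrad u x ^ θ) (ℓ := logGrad u x) (θ := θ) (κ := κ)
    (k := k) (d := 2 / (R ^ 2 * cutoff R x)) (exp_pos _) hv hℓ (by positivity) hk
    (fun i j => pd1_pd1_comm hu2 i j)
    (fun i => by rw [hv]; exact two_mul_sum_eq_pd1_logGrad hu2 i)
    (fun i => by rw [hv]; exact laplacian_logGrad_identity hu i)
    (differentiated_equation hu (hasDerivAt_exp_half_mul_rpow m θ hℓ) heq) heqx
    (fun i => by
      have h := hfirst (hlogℓ.differentiableAt (by norm_num)) (hlogσ.differentiableAt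
        (by norm_num)) (hu2.differentiableAt (by norm_num)) i
      rw [hmax.pd1_eq_zero, pd1_log (hℓ2.differentiableAt (by norm_num)) hℓ.ne',
        pd1_log (hσ2.differentiableAt (by norm_num)) hσ0.ne'] at h
      have : pd1 (logGrad u) i x / logGrad u x =
        κ * pd1 u i x - k * (pd1 (cutoff R) i x / cutoff R x) := by linarith
      rw [← this]
      field_simp)
    (fun w => by
      refine le_of_eq_of_le ?_ (hmax.sum_pd1_pd1_nonpos hΦ w)
      refine Finset.sum_congr rfl fun i _ => Finset.sum_congr rfl fun j _ => ?_
      rw [hsecond, pd1_pd1_log hℓ2 hℓ.ne', pd1_pd1_log hσ2 hσ0.ne', pd1_pd1_cutoff]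
      split_ifs
      · field_simp
        ring
      · field_simp
        ring)
  rw [hP] at hmain
  refine ⟨_, _, _, ?_, ?_, ?_, hmain⟩
  · have h1 : ∑ i, (pd1 (cutoff R) i x / cutoff R x) ^ 2 =
        4 * (‖x‖ ^ 2 / R ^ 2 * (1 / (R * cutoff R x) ^ 2)) := by
      rw [EuclideanSpace.real_norm_sq_eq, Finset.sum_div, Finset.sum_mul, Finset.mul_sum]
      refine Finset.sum_congr rfl fun i _ => ?_
      rw [pd1_cutoff]
      field_simp
      norm_num [mul_comm]
    have h2 : ‖x‖ ^ 2 / R ^ 2 ≤ 1 := by rw [div_le_one (by positivity)]; gcongr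
    rw [h1]
    have h3 : 0 ≤ 1 / (R * cutoff R x) ^ 2 := by positivity
    nlinarith
  · rw [← hP]
    exact Finset.sum_mul_sq_le_sq_mul_sq _ _ _
  · rw [mul_one_div]
    rw [mul_pow]
    gcongr
    nlinarith

end Bernstein

section GradientBound

open Topology

variable {n : ℕ} {u : EuclideanSpace ℝ (Fin n) → ℝ} {x : EuclideanSpace ℝ (Fin n)}

lemma one_add_norm_gradient_sq : 1 + ‖gradient u x‖ ^ 2 = exp (logGrad u x) := by
  rw [exp_logGrad, norm_gradient_sq]

lemma logGrad_nonneg : 0 ≤ logGrad u x :=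
  log_nonneg (by linarith [Finset.sum_nonneg fun i (_ : i ∈ Finset.univ) => sq_nonneg (pd1 u i x)])

lemma gradient_ne_zero_of_logGrad_pos (h : 0 < logGrad u x) : gradient u x ≠ 0 := by
  intro h0
  have := one_add_norm_gradient_sq (u := u) (x := x)
  rw [h0] at this
  have := one_lt_exp_iff.mpr h
  simp_all

lemma continuousOn_logGrad {s : Set (EuclideanSpace ℝ (Fin n))} (hs : IsOpen s)
    (hu : ContDiffOn ℝ 1 u s) : ContinuousOn (logGrad u) s := fun _ hx =>
  (contDiffAt_logGrad (m := 0) (hu.contDiffAt (hs.mem_nhds hx))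
    (by norm_num)).continuousAt.continuousWithinAt

/-- A nonnegative weighted version of `logGrad u` attains its maximum over a closed ball in the
open ball, where its logarithm has a local maximum. -/
lemma exists_isLocalMax_log {R k κ : ℝ} (hR : 0 < R) (hk : 0 < k)
    {s : Set (EuclideanSpace ℝ (Fin n))} (hs : IsOpen s) (hsub : closedBall 0 R ⊆ s)
    (hu : ContDiffOn ℝ 1 u s) (h0 : 0 < logGrad u 0) :
    ∃ x, ‖x‖ < R ∧ 0 < logGrad u x ∧
      logGrad u 0 * exp (-(κ * u 0)) ≤ cutoff R x ^ k * logGrad u x * exp (-(κ * u x)) ∧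
      IsLocalMax (fun y => log (logGrad u y) + k * log (cutoff R y) - κ * u y) x := by
  have hℓc := continuousOn_logGrad hs hu
  have hσc : Continuous (cutoff (n := n) R) := (contDiff_cutoff (k := 0) R).continuous
  have hcont : ContinuousOn (fun y => cutoff R y ^ k * logGrad u y * exp (-(κ * u y)))
      (closedBall 0 R) := by
    refine ContinuousOn.mono (s := s) ?_ hsub
    exact ((hσc.continuousOn.rpow_const fun _ _ => Or.inr hk.le).mul hℓc).mul
      ((continuousOn_const.mul hu.continuousOn).neg.rexp)
  obtain ⟨x, hxR, hx⟩ := (isCompact_closedBall (0 : EuclideanSpace ℝ (Fin n)) R).exists_isMaxOn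
    ⟨0, mem_closedBall_self hR.le⟩ hcont
  have hge : logGrad u 0 * exp (-(κ * u 0)) ≤
      cutoff R x ^ k * logGrad u x * exp (-(κ * u x)) := by
    have := hx (mem_closedBall_self hR.le)
    simpa [cutoff] using this
  have hpos : 0 < cutoff R x ^ k * logGrad u x * exp (-(κ * u x)) :=
    lt_of_lt_of_le (by positivity) hge
  have hprod : 0 < cutoff R x ^ k * logGrad u x := pos_of_mul_pos_left hpos (exp_pos _).le
  have hxR' : ‖x‖ ≤ R := by simpa using hxR
  have hlt : ‖x‖ < R := by
    refine lt_of_le_of_ne hxR' fun h => ?_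
    have h1 : cutoff R x = 0 := by
      rw [cutoff, h, div_self (by positivity), sub_self]
    rw [h1, Real.zero_rpow hk.ne'] at hprod
    simp at hprod
  have hσ {y : EuclideanSpace ℝ (Fin n)} (hy : ‖y‖ < R) : 0 < cutoff R y := by
    rw [cutoff, sub_pos, div_lt_one (by positivity)]
    gcongr
  have hℓ : 0 < logGrad u x := pos_of_mul_pos_right hprod (rpow_nonneg (hσ hlt).le _)
  refine ⟨x, hlt, hℓ, hge, ?_⟩
  have hlog {y : EuclideanSpace ℝ (Fin n)} (hy : ‖y‖ < R) (hy' : 0 < logGrad u y) :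
      log (cutoff R y ^ k * logGrad u y * exp (-(κ * u y))) =
        log (logGrad u y) + k * log (cutoff R y) - κ * u y := by
    have h1 := rpow_pos_of_pos (hσ hy) k
    rw [log_mul (mul_pos h1 hy').ne' (exp_pos _).ne', log_mul h1.ne' hy'.ne', log_exp,
      log_rpow (hσ hy)]
    ring
  have hℓev : ∀ᶠ y in 𝓝 x, 0 < logGrad u y :=
    (hℓc.continuousAt (hs.mem_nhds (hsub hxR))).eventually (lt_mem_nhds hℓ)
  have hball : ∀ᶠ y in 𝓝 x, ‖y‖ < R := continuous_norm.continuousAt.eventually (gt_mem_nhds hlt)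
  filter_upwards [hℓev, hball] with y hy hyR
  rw [← hlog hyR hy, ← hlog hlt hℓ]
  refine log_le_log ?_ (hx (by simpa using hyR.le))
  have := rpow_pos_of_pos (hσ hyR) k
  positivity

/-- The interior bound for `logGrad u 0` behind the gradient estimate. -/
lemma logGrad_rpow_le (hn : 1 ≤ n) {θ m : ℝ} (hθ0 : 0 < θ) (hθ1 : θ ≤ 1) (hm : 0 < m)
    {ε δ C R L : ℝ} (hε0 : 0 < ε) (hε1 : ε ≤ 1) (hεm : ε ≤ m / (4 * n)) (hεθ : ε ≤ θ * m / 4)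
    (hC : C = 18 * n * θ⁻¹ ^ 2 + 4 * (2 * θ⁻¹ ^ 2 + θ⁻¹) + 2 * θ⁻¹ * n)
    (hδ0 : 0 < δ) (hδm : 2 * C * δ < m ^ 2 / n) (hδθ : 2 * C * δ < θ * m / 96) (hR : 0 < R)
    (hu1 : ContDiffOn ℝ 1 u (ball 0 R))
    (hu3 : ContDiffOn ℝ 3 u (ball 0 R ∩ {x | gradient u x ≠ 0}))
    (heq : ∀ x ∈ ball (0 : EuclideanSpace ℝ (Fin n)) R, gradient u x ≠ 0 →
      mcOp u x = √(1 + ‖gradient u x‖ ^ 2) * (m * log (1 + ‖gradient u x‖ ^ 2) ^ θ))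
    (hL : ∀ x ∈ ball (0 : EuclideanSpace ℝ (Fin n)) R, ∀ y ∈ ball (0 : EuclideanSpace ℝ (Fin n)) R,
      |u x - u y| ≤ L) :
    logGrad u 0 ^ (2 * θ) ≤ exp 2 / (δ * ε) * (L + 1) / R ^ 2 := by
  have h0mem : (0 : EuclideanSpace ℝ (Fin n)) ∈ ball (0 : EuclideanSpace ℝ (Fin n)) R :=
    mem_ball_self hR
  have hL0 : 0 ≤ L := by simpa using hL 0 h0mem 0 h0mem
  by_contra! hlt
  obtain ⟨r, hr0, hrR, hr⟩ : ∃ r, 0 < r ∧ r < R ∧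
      exp 2 / (δ * ε) * (L + 1) / r ^ 2 < logGrad u 0 ^ (2 * θ) := by
    have hc : ContinuousAt (fun r : ℝ => exp 2 / (δ * ε) * (L + 1) / r ^ 2) R :=
      continuousAt_const.div (continuousAt_id.pow 2) (by positivity)
    have h1 : ∀ᶠ r in 𝓝[<] R, exp 2 / (δ * ε) * (L + 1) / r ^ 2 < logGrad u 0 ^ (2 * θ) :=
      (hc.eventually (gt_mem_nhds hlt)).filter_mono nhdsWithin_le_nhds
    have h2 : ∀ᶠ r in 𝓝[<] R, 0 < r := (lt_mem_nhds hR).filter_mono nhdsWithin_le_nhds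
    obtain ⟨r, h1, h2, h3⟩ := (h1.and (h2.and self_mem_nhdsWithin)).exists
    exact ⟨r, h2, h3, h1⟩
  set κ := ε / (L + 1) with hκ
  have hκ0 : 0 < κ := by positivity
  have hκε : κ ≤ ε := div_le_self hε0.le (by linarith)
  have hκL : κ * L ≤ 1 := by
    have : κ * (L + 1) = ε := by rw [hκ]; field_simp
    nlinarith
  have h0pos : 0 < logGrad u 0 := by
    refine lt_of_le_of_ne logGrad_nonneg fun h => ?_
    rw [← h, Real.zero_rpow (by positivity)] at hr
    have : 0 < exp 2 / (δ * ε) * (L + 1) / r ^ 2 := by positivity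
    linarith
  obtain ⟨x, hxr, hℓ, hge, hmax⟩ := exists_isLocalMax_log (k := θ⁻¹) (κ := κ) hr0 (by positivity)
    isOpen_ball (closedBall_subset_ball hrR) hu1 h0pos
  have hxmem : x ∈ ball (0 : EuclideanSpace ℝ (Fin n)) R := by
    simpa using hxr.trans hrR
  have hev : ∀ᶠ y in 𝓝 x, y ∈ ball (0 : EuclideanSpace ℝ (Fin n)) R ∧ gradient u y ≠ 0 := by
    filter_upwards [isOpen_ball.mem_nhds hxmem, ((continuousOn_logGrad isOpen_ball hu1).continuousAt
      (isOpen_ball.mem_nhds hxmem)).eventually (lt_mem_nhds hℓ)] with y hy hy'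
      using ⟨hy, gradient_ne_zero_of_logGrad_pos hy'⟩
  have hux : ContDiffAt ℝ 3 u x := hu3.contDiffAt hev
  have heq' : ∀ᶠ y in 𝓝 x, mcOp u y = exp (logGrad u y / 2) * (m * logGrad u y ^ θ) := by
    filter_upwards [hev] with y hy
    rw [heq y hy.1 hy.2, one_add_norm_gradient_sq, log_exp, exp_half]
  obtain ⟨G, N, d, hN, hG, hd, hmain⟩ := inequality_at_local_max hn (by positivity) hr0 hxr hux hℓ
    heq' hmax
  have hσ : 0 < cutoff r x := by
    rw [cutoff, sub_pos, div_lt_one (by positivity)]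
    gcongr
  have hρ : 1 / (r * cutoff r x) ^ 2 ≤ δ * κ * (logGrad u x ^ θ) ^ 2 := by
    have h1 : logGrad u 0 ≤ exp 1 * (cutoff r x ^ θ⁻¹ * logGrad u x) := by
      have h2 : logGrad u 0 ≤ cutoff r x ^ θ⁻¹ * logGrad u x * exp (κ * (u 0 - u x)) := by
        have h3 := mul_le_mul_of_nonneg_right hge (exp_pos (κ * u 0)).le
        rwa [mul_assoc, mul_assoc, ← exp_add, ← exp_add, neg_add_cancel, exp_zero, mul_one,
          show -(κ * u x) + κ * u 0 = κ * (u 0 - u x) by ring] at h3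
      have h4 : κ * (u 0 - u x) ≤ 1 := by
        have h5 := (le_abs_self _).trans (hL 0 h0mem x hxmem)
        nlinarith
      have h6 : 0 ≤ cutoff r x ^ θ⁻¹ * logGrad u x := by positivity
      rw [mul_comm (exp 1)]
      exact h2.trans (mul_le_mul_of_nonneg_left (exp_le_exp.mpr h4) h6)
    have h2 : logGrad u 0 ^ (2 * θ) ≤ exp 2 * (cutoff r x ^ 2 * (logGrad u x ^ θ) ^ 2) := by
      have h3 := rpow_le_rpow h0pos.le h1 (by positivity : 0 ≤ 2 * θ)
      rw [mul_rpow (exp_pos _).le (by positivity), mul_rpow (by positivity) hℓ.le,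
        ← rpow_mul hσ.le, ← exp_mul, show θ⁻¹ * (2 * θ) = (2 : ℕ) by push_cast; field_simp,
        rpow_natCast, mul_comm 2 θ, rpow_mul hℓ.le] at h3
      rw [mul_comm 2 θ]
      refine h3.trans ?_
      rw [rpow_two]
      have h4 : exp (1 * (θ * 2)) ≤ exp 2 := exp_le_exp.mpr (by linarith)
      gcongr
    have h3 := hr.trans_le h2
    have hA : 0 ≤ (logGrad u x ^ θ) ^ 2 := sq_nonneg _
    rw [div_lt_iff₀ (by positivity), div_mul_eq_mul_div, div_lt_iff₀ (by positivity)] at h3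
    have h5 : L + 1 < δ * ε * (r * cutoff r x) ^ 2 * (logGrad u x ^ θ) ^ 2 := by
      refine lt_of_mul_lt_mul_left ?_ (exp_pos 2).le
      linarith
    rw [div_le_iff₀ (by positivity), hκ]
    have h6 : δ * (ε / (L + 1)) * (logGrad u x ^ θ) ^ 2 * (r * cutoff r x) ^ 2 =
      δ * ε * (r * cutoff r x) ^ 2 * (logGrad u x ^ θ) ^ 2 / (L + 1) := by ring
    rw [h6, le_div_iff₀ (by positivity)]
    linarith
  have hn' : (0 : ℝ) < n := by exact_mod_cast hn
  refine scalar_inequality_false hn hθ0 hθ1 hm (k := θ⁻¹) (by positivity) hε1 hεm hεθ hC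
    (by rw [hC]; positivity) hδm hδθ hℓ (a := logGrad u x ^ θ) ?_ ?_ hκ0 hκε hρ rfl rfl rfl hN hG
    hd hmain
  · intro h
    simpa using rpow_le_rpow_of_exponent_ge hℓ h hθ1
  · intro h
    exact ⟨one_le_rpow h hθ0.le, by simpa using rpow_le_rpow_of_exponent_le h hθ1⟩

end GradientBound

/-- Theorem 1.1 (c): interior gradient estimate for
`f(p) = m₁ log^θ(1+|p|²)` with `0 < θ ≤ 1`, in terms of the oscillation `L`.
The constant `C₁` depends only on `n, m₁, θ`; the constant `C₂` also on `η`. -/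
theorem gradient_estimate_A3 (n : ℕ) (hn : 1 ≤ n) (θ m₁ : ℝ)
    (hθ₀ : 0 < θ) (hθ₁ : θ ≤ 1) (hm₁ : 0 < m₁) :
    ∃ C₁ > (0 : ℝ), ∀ η : ℝ, 0 < η → η < 1 →
      ∃ C₂ > (0 : ℝ), ∀ R : ℝ, 0 < R →
        ∀ u : EuclideanSpace ℝ (Fin n) → ℝ,
          ContDiffOn ℝ 1 u (ball 0 R) →
          ContDiffOn ℝ 3 u (ball 0 R ∩ {x | gradient u x ≠ 0}) →
          (∀ x ∈ ball (0 : EuclideanSpace ℝ (Fin n)) R, gradient u x ≠ 0 →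
            mcOp u x = Real.sqrt (1 + ‖gradient u x‖ ^ 2) *
              (m₁ * Real.log (1 + ‖gradient u x‖ ^ 2) ^ θ)) →
          ∀ L : ℝ,
            (∀ x ∈ ball (0 : EuclideanSpace ℝ (Fin n)) R,
              ∀ y ∈ ball (0 : EuclideanSpace ℝ (Fin n)) R, |u x - u y| ≤ L) →
            ‖gradient u 0‖ ^ 2 ≤
              max (Real.exp (C₁ * (L + 1) ^ (1 / (2 * θ)) / R ^ (1 / θ)) - 1)
                (Real.exp (C₂ * (L + 1) ^ (1 / (1 - η)) / R ^ (2 / (1 - η))) - 1) := by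
  have hn' : (0 : ℝ) < n := by exact_mod_cast hn
  obtain ⟨ε, hε0, hε1, hεm, hεθ⟩ :
      ∃ ε : ℝ, 0 < ε ∧ ε ≤ 1 ∧ ε ≤ m₁ / (4 * n) ∧ ε ≤ θ * m₁ / 4 :=
    ⟨min 1 (min (m₁ / (4 * n)) (θ * m₁ / 4)), by positivity, min_le_left _ _,
      (min_le_right _ _).trans (min_le_left _ _), (min_le_right _ _).trans (min_le_right _ _)⟩
  obtain ⟨C, hC⟩ : ∃ C : ℝ, C = 18 * n * θ⁻¹ ^ 2 + 4 * (2 * θ⁻¹ ^ 2 + θ⁻¹) + 2 * θ⁻¹ * n :=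
    ⟨_, rfl⟩
  have hC0 : 0 < C := by rw [hC]; positivity
  obtain ⟨δ, hδ0, hδm, hδθ⟩ :
      ∃ δ : ℝ, 0 < δ ∧ 2 * C * δ < m₁ ^ 2 / n ∧ 2 * C * δ < θ * m₁ / 96 := by
    obtain ⟨b, hb0, hb⟩ := exists_between (show 0 < min (m₁ ^ 2 / n) (θ * m₁ / 96) by positivity)
    obtain ⟨hb1, hb2⟩ := lt_min_iff.mp hb
    have : 2 * C * (b / (2 * C)) = b := by field_simp
    exact ⟨b / (2 * C), by positivity, by rwa [this], by rwa [this]⟩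
  refine ⟨(exp 2 / (δ * ε)) ^ (1 / (2 * θ)), by positivity, fun η _ _ => ⟨1, one_pos, ?_⟩⟩
  intro R hR u hu1 hu3 heq L hL
  refine le_max_of_le_left ?_
  have hL0 : 0 ≤ L := by simpa using hL 0 (mem_ball_self hR) 0 (mem_ball_self hR)
  have h := logGrad_rpow_le hn hθ₀ hθ₁ hm₁ hε0 hε1 hεm hεθ hC hδ0 hδm hδθ hR hu1 hu3 heq hL
  have h1 := rpow_le_rpow (rpow_nonneg logGrad_nonneg _) h (by positivity : 0 ≤ 1 / (2 * θ))
  rw [← rpow_mul logGrad_nonneg, mul_one_div_cancel (by positivity), rpow_one,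
    div_rpow (by positivity) (by positivity), mul_rpow (by positivity) (by positivity),
    ← rpow_natCast R, ← rpow_mul hR.le, show ((2 : ℕ) : ℝ) * (1 / (2 * θ)) = 1 / θ by
      push_cast; field_simp] at h1
  have h2 := exp_le_exp.mpr h1
  rw [← one_add_norm_gradient_sq] at h2
  linarith
end
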